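/- For every infinite basically disconnected compact Hausdorff space K there exist a compact Hausdorff space L and a continuous surjection φ : K → L such that L does not have the Grothendieck property but L has the ℓ1-Grothendieck property. -/

import Mathlib

open MeasureTheory Filter Topology Set
open scoped ENNReal

namespace JNP

variable {K : Type*} [TopologicalSpace K] [MeasurableSpace K] [BorelSpace K]

/-- The total variation norm of a signed Borel measure. -/
noncomputable def tvNorm (μ : SignedMeasure K) : ℝ :=
  (μ.totalVariation Set.univ).toReal

/-- A signed Borel measure is Radon if its total variation is a regular measure. -/
def IsRadon (μ : SignedMeasure K) : Prop :=
  μ.totalVariation.Regular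

/-- The integral of a function against a signed measure. -/
noncomputable def integ (μ : SignedMeasure K) (f : K → ℝ) : ℝ :=
  ∫ x, f x ∂μ.toJordanDecomposition.posPart -
    ∫ x, f x ∂μ.toJordanDecomposition.negPart

/-- The support of a signed measure: the set of points all of whose open
neighbourhoods have nonzero total variation. -/
def msupport (μ : SignedMeasure K) : Set K :=
  {x : K | ∀ U : Set K, IsOpen U → x ∈ U → μ.totalVariation U ≠ 0}

/-- Weak* convergence of a sequence of signed measures: convergence of the integrals of
every continuous real-valued function. -/
def WeakStarTendsto (μs : ℕ → SignedMeasure K) (μ : SignedMeasure K) : Prop :=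
  ∀ f : C(K, ℝ), Tendsto (fun n => integ (μs n) f) atTop (𝓝 (integ μ f))

/-- A sequence of signed measures is weak* null if the integral of every continuous
real-valued function tends to `0`. -/
def WeakStarNull (μs : ℕ → SignedMeasure K) : Prop :=
  ∀ f : C(K, ℝ), Tendsto (fun n => integ (μs n) f) atTop (𝓝 (0 : ℝ))

/-- Weak convergence of a sequence of signed measures: convergence under every bounded
linear functional on the Banach space of signed measures with the total variation norm
(which, for Radon measures, is `C(K)*` by the Riesz representation theorem). -/
def WeakTendsto (μs : ℕ → SignedMeasure K) (μ : SignedMeasure K) : Prop :=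
  ∀ φ : SignedMeasure K →ₗ[ℝ] ℝ,
    (∃ C : ℝ, ∀ ν : SignedMeasure K, |φ ν| ≤ C * tvNorm ν) →
    Tendsto (fun n => φ (μs n)) atTop (𝓝 (φ μ))

variable (K) in
/-- The Grothendieck property: every weak* convergent sequence of signed Radon measures
is weakly convergent. -/
def GrothendieckProp : Prop :=
  ∀ (μs : ℕ → SignedMeasure K) (μ : SignedMeasure K),
    (∀ n, IsRadon (μs n)) → IsRadon μ → WeakStarTendsto μs μ → WeakTendsto μs μ

variable (K) in
/-- The ℓ₁-Grothendieck property: every weak* convergent sequence of countably supported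
signed Radon measures is weakly convergent. -/
def Ell1Grothendieck : Prop :=
  ∀ (μs : ℕ → SignedMeasure K) (μ : SignedMeasure K),
    (∀ n, IsRadon (μs n)) → (∀ n, (msupport (μs n)).Countable) →
    IsRadon μ → WeakStarTendsto μs μ → WeakTendsto μs μ

variable (K) in
/-- The Δ-Grothendieck property: every weak* convergent sequence of finitely supported
signed Radon measures is weakly convergent. -/
def DeltaGrothendieck : Prop :=
  ∀ (μs : ℕ → SignedMeasure K) (μ : SignedMeasure K),
    (∀ n, IsRadon (μs n)) → (∀ n, (msupport (μs n)).Finite) →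
    IsRadon μ → WeakStarTendsto μs μ → WeakTendsto μs μ

variable (K) in
/-- The finitely supported Josefson–Nissenzweig property: there is a weak* null sequence of
finitely supported signed Radon measures of total variation norm one. -/
def fsJNP : Prop :=
  ∃ μs : ℕ → SignedMeasure K,
    (∀ n, IsRadon (μs n)) ∧ (∀ n, (msupport (μs n)).Finite) ∧
    (∀ n, tvNorm (μs n) = 1) ∧ WeakStarNull μs

variable (K) in
/-- The countably supported Josefson–Nissenzweig property: there is a weak* null sequence of
countably supported signed Radon measures of total variation norm one. -/
def csJNP : Prop :=
  ∃ μs : ℕ → SignedMeasure K,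
    (∀ n, IsRadon (μs n)) ∧ (∀ n, (msupport (μs n)).Countable) ∧
    (∀ n, tvNorm (μs n) = 1) ∧ WeakStarNull μs

end JNP

/-- A subset of a topological space is a zero set if it is the preimage of `{0}` under a
continuous real-valued function. -/
def IsZeroSet {X : Type*} [TopologicalSpace X] (A : Set X) : Prop :=
  ∃ f : C(X, ℝ), A = f ⁻¹' {0}

/-- A topological space is basically disconnected if the closure of every cozero set is open. -/
def BasicallyDisconnected (X : Type*) [TopologicalSpace X] : Prop :=
  ∀ A : Set X, IsZeroSet Aᶜ → IsOpen (closure A)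

namespace JNP

/-- The pairing of a finitely supported function with a function. -/
noncomputable def pair {X : Type*} (η : X →₀ ℝ) (f : X → ℝ) : ℝ := ∑ x ∈ η.support, η x * f x

/-- The mass that a finitely supported function puts on a set. -/
noncomputable def mass {X : Type*} (η : X →₀ ℝ) (A : Set X) : ℝ :=
  ∑ x ∈ η.support, |η x| * A.indicator 1 x

theorem pair_sub {X : Type*} (η ζ : X →₀ ℝ) (f : X → ℝ) :
    pair (η - ζ) f = pair η f - pair ζ f :=
  Finsupp.sum_sub_index (h := fun x a => a * f x) fun x a b => sub_mul a b (f x)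

theorem abs_pair_le_mass {X : Type*} (η : X →₀ ℝ) {f : X → ℝ} (hf : ∀ x, |f x| ≤ 1) :
    |pair η f| ≤ mass η univ := by
  refine (Finset.abs_sum_le_sum_abs _ _).trans (Finset.sum_le_sum fun x _ => ?_)
  rw [abs_mul]
  simpa using mul_le_mul_of_nonneg_left (hf x) (abs_nonneg (η x))

/-- The charge that a finitely supported function gives to a set. -/
noncomputable def chg {X : Type*} (η : X →₀ ℝ) (A : Set X) : ℝ := pair η (A.indicator 1)

section Finsupp

variable {X : Type*} (η : X →₀ ℝ)

theorem mass_nonneg (A : Set X) : 0 ≤ mass η A :=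
  Finset.sum_nonneg fun _ _ =>
    mul_nonneg (abs_nonneg _) (indicator_nonneg (fun _ _ => zero_le_one) _)

theorem mass_mono {A B : Set X} (h : A ⊆ B) : mass η A ≤ mass η B :=
  Finset.sum_le_sum fun _ _ => mul_le_mul_of_nonneg_left
    (indicator_le_indicator_of_subset h (fun _ => zero_le_one) _) (abs_nonneg _)

theorem mass_union {A B : Set X} (h : Disjoint A B) : mass η (A ∪ B) = mass η A + mass η B := by
  unfold mass
  rw [indicator_union_of_disjoint h, ← Finset.sum_add_distrib]
  exact Finset.sum_congr rfl fun _ _ => mul_add _ _ _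

theorem mass_empty : mass η ∅ = 0 := by simp [mass]

theorem mass_union_le (A B : Set X) : mass η (A ∪ B) ≤ mass η A + mass η B := by
  rw [← union_sdiff_self, mass_union _ disjoint_sdiff_right]
  gcongr
  exact mass_mono _ sdiff_subset

theorem sum_mass_le {ι : Type*} (s : Finset ι) {V : ι → Set X}
    (h : (s : Set ι).PairwiseDisjoint V) : ∑ k ∈ s, mass η (V k) ≤ mass η univ := by
  have : ∑ k ∈ s, mass η (V k) = mass η (⋃ k ∈ s, V k) := by
    classical
    induction s using Finset.induction_on with
    | empty => simp [mass_empty]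
    | insert a s ha ih =>
      rw [Finset.sum_insert ha, ih (h.subset (by simp)), Finset.set_biUnion_insert, mass_union]
      rw [disjoint_iUnion₂_right]
      intro i hi
      exact h (by simp) (by simp [hi]) (by rintro rfl; exact ha hi)
  rw [this]
  exact mass_mono _ (subset_univ _)

theorem mass_biUnion_le {ι : Type*} (s : Finset ι) (V : ι → Set X) :
    mass η (⋃ k ∈ s, V k) ≤ ∑ k ∈ s, mass η (V k) := by
  classical
  induction s using Finset.induction_on with
  | empty => simp [mass_empty]
  | insert a s ha ih =>
    rw [Finset.sum_insert ha, Finset.set_biUnion_insert]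
    exact (mass_union_le _ _ _).trans (by gcongr)

theorem chg_union {A B : Set X} (h : Disjoint A B) : chg η (A ∪ B) = chg η A + chg η B := by
  unfold chg pair
  rw [indicator_union_of_disjoint h, ← Finset.sum_add_distrib]
  exact Finset.sum_congr rfl fun _ _ => mul_add _ _ _

theorem chg_sdiff_add_inter (A B : Set X) : chg η (A \ B) + chg η (A ∩ B) = chg η A := by
  rw [← chg_union _ (disjoint_sdiff_inter), sdiff_union_inter]

theorem abs_chg_le_mass (A : Set X) : |chg η A| ≤ mass η A := by
  refine (Finset.abs_sum_le_sum_abs _ _).trans (Finset.sum_le_sum fun x _ => ?_)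
  rw [abs_mul, abs_of_nonneg (a := A.indicator 1 x) (indicator_nonneg (fun _ _ => zero_le_one) _)]

variable {η} in
theorem chg_congr {A B : Set X} (h : ∀ x ∈ η.support, x ∈ A ↔ x ∈ B) : chg η A = chg η B :=
  Finset.sum_congr rfl fun x hx => by
    by_cases hA : x ∈ A
    · simp [hA, (h x hx).1 hA]
    · simp [hA, mt (h x hx).2 hA]

theorem mass_coe_finset (Q : Finset X) : mass η Q = ∑ x ∈ Q, |η x| := by
  classical
  have h1 : mass η Q = ∑ x ∈ η.support ∪ Q, |η x| * (Q : Set X).indicator 1 x :=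
    Finset.sum_subset Finset.subset_union_left fun x _ hx => by
      rw [Finsupp.notMem_support_iff.1 hx, abs_zero, zero_mul]
  have h2 : ∑ x ∈ Q, |η x| * (Q : Set X).indicator 1 x
      = ∑ x ∈ η.support ∪ Q, |η x| * (Q : Set X).indicator 1 x :=
    Finset.sum_subset Finset.subset_union_right fun x _ hx => by simp [hx]
  rw [h1, ← h2]
  exact Finset.sum_congr rfl fun x hx => by simp [hx]

end Finsupp

/-- Weak* null sequences of finitely supported measures. -/
def WNull {X : Type*} [TopologicalSpace X] (θ : ℕ → X →₀ ℝ) : Prop :=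
  ∀ f : C(X, ℝ), Tendsto (fun j => pair (θ j) f) atTop (𝓝 0)

theorem WNull.comp {X : Type*} [TopologicalSpace X] {θ : ℕ → X →₀ ℝ} (h : WNull θ) {n : ℕ → ℕ}
    (hn : Tendsto n atTop atTop) : WNull fun j => θ (n j) := fun f => (h f).comp hn

/-- Weak* null sequences of finitely supported measures are norm null. -/
def FinSchur (X : Type*) [TopologicalSpace X] : Prop :=
  ∀ θ : ℕ → X →₀ ℝ, WNull θ →
    Tendsto (fun j => mass (θ j) univ) atTop (𝓝 0)

section SignedMeasures

theorem _root_.ContinuousMap.integrable_of_isFiniteMeasure {L : Type*} [TopologicalSpace L]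
    [CompactSpace L] [MeasurableSpace L] [BorelSpace L] (f : C(L, ℝ)) (α : Measure L)
    [IsFiniteMeasure α] : Integrable f α :=
  f.continuous.integrable_of_hasCompactSupport (HasCompactSupport.of_compactSpace _)

theorem exists_compl_null {L : Type*} [MeasurableSpace L] (σ : SignedMeasure L) :
    ∃ P : Set L, MeasurableSet P ∧ σ.toJordanDecomposition.posPart Pᶜ = 0 ∧
      σ.toJordanDecomposition.negPart P = 0 := by
  obtain ⟨S, hS, h1, h2⟩ := σ.toJordanDecomposition.mutuallySingular
  exact ⟨Sᶜ, hS.compl, by simpa using h1, h2⟩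

theorem exists_finset_compl_small {L : Type*} [TopologicalSpace L] [T2Space L] [MeasurableSpace L]
    [BorelSpace L] {μ : SignedMeasure L} (hμ : IsRadon μ)
    (hs : (msupport μ).Countable) {ε : ℝ} (hε : 0 < ε) :
    ∃ T : Finset L, μ.totalVariation.real (T : Set L)ᶜ ≤ ε := by
  have := hμ
  unfold IsRadon at this
  set τ := μ.totalVariation with hτ
  have hsupp : τ.support ⊆ msupport μ := by
    intro x hx U hU hxU
    exact ((Measure.mem_support_iff_forall x).1 hx U (hU.mem_nhds hxU)).ne'
  have h0 : τ (msupport μ)ᶜ = 0 :=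
    measure_mono_null (compl_subset_compl.2 hsupp) Measure.measure_compl_support_of_regular
  have key : ∀ S : Set L, S.Countable → τ Sᶜ = 0 → ∃ T : Finset L, τ.real (T : Set L)ᶜ ≤ ε := by
    intro S hS hS0
    rcases S.eq_empty_or_nonempty with rfl | hne
    · refine ⟨∅, ?_⟩
      rw [Finset.coe_empty, measureReal_def, hS0]
      simpa using hε.le
    classical
    obtain ⟨e, rfl⟩ := hS.exists_eq_range hne
    have hlim := tendsto_measure_iInter_atTop (μ := τ)
      (s := fun n => ((Finset.image e (Finset.range n) : Finset L) : Set L)ᶜ)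
      (fun n => (Finset.measurableSet _).compl.nullMeasurableSet)
      (fun m n hmn => compl_subset_compl.2 (by
        gcongr)) ⟨0, measure_ne_top _ _⟩
    have hi : ⋂ n, ((Finset.image e (Finset.range n) : Finset L) : Set L)ᶜ = (range e)ᶜ := by
      ext x
      simp only [mem_iInter, mem_compl_iff, Finset.mem_coe, Finset.mem_image, Finset.mem_range,
        mem_range]
      constructor
      · rintro h ⟨k, rfl⟩
        exact h (k + 1) ⟨k, by omega, rfl⟩
      · rintro h n ⟨k, -, hk⟩
        exact h ⟨k, hk⟩
    rw [hi, hS0] at hlim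
    obtain ⟨n, hn⟩ := (hlim.eventually_lt_const (u := ENNReal.ofReal ε)
      (ENNReal.ofReal_pos.2 hε)).exists
    exact ⟨_, ENNReal.toReal_le_of_le_ofReal hε.le hn.le⟩
  exact key _ hs h0

theorem integ_sub {L : Type*} [TopologicalSpace L] [CompactSpace L] [MeasurableSpace L]
    [BorelSpace L] (μ ν : SignedMeasure L) (f : C(L, ℝ)) :
    integ (μ - ν) f = integ μ f - integ ν f := by
  have key : (μ - ν).toJordanDecomposition.posPart + μ.toJordanDecomposition.negPart
        + ν.toJordanDecomposition.posPart
      = (μ - ν).toJordanDecomposition.negPart + μ.toJordanDecomposition.posPart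
        + ν.toJordanDecomposition.negPart := by
    ext s hs
    have h1 := (μ - ν).apply_eq_posPart_real_sub_negPart_real hs
    have h2 := μ.apply_eq_posPart_real_sub_negPart_real hs
    have h3 := ν.apply_eq_posPart_real_sub_negPart_real hs
    have h4 : (μ - ν) s = μ s - ν s := rfl
    rw [← measureReal_eq_measureReal_iff]
    rw [measureReal_add_apply, measureReal_add_apply, measureReal_add_apply,
      measureReal_add_apply]
    linarith
  have h := congrArg (fun α : Measure L => ∫ x, f x ∂α) key
  beta_reduce at h
  have hi := fun (α : Measure L) (_ : IsFiniteMeasure α) => f.integrable_of_isFiniteMeasure α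
  rw [integral_add_measure (hi _ inferInstance) (hi _ inferInstance),
    integral_add_measure (hi _ inferInstance) (hi _ inferInstance),
    integral_add_measure (hi _ inferInstance) (hi _ inferInstance),
    integral_add_measure (hi _ inferInstance) (hi _ inferInstance)] at h
  unfold integ
  linarith

variable {L : Type*} [TopologicalSpace L] [CompactSpace L] [T2Space L]
  [MeasurableSpace L] [BorelSpace L]

/-- Norm of a regular signed measure from below. -/
theorem tvNorm_le_of_forall_integ_le {μ ν : SignedMeasure L} (hμ : IsRadon μ) (hν : IsRadon ν)
    {c : ℝ} (h : ∀ f : C(L, ℝ), (∀ x, |f x| ≤ 1) → |integ (μ - ν) f| ≤ c) :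
    tvNorm (μ - ν) ≤ c := by
  set σ := μ - ν with hσ
  obtain ⟨P, hP, hp, hn⟩ := exists_compl_null σ
  set p := σ.toJordanDecomposition.posPart
  set n := σ.toJordanDecomposition.negPart
  have := hμ
  have := hν
  unfold IsRadon at *
  have happ : ∀ B, MeasurableSet B → |σ B| ≤ μ.totalVariation.real B + ν.totalVariation.real B := by
    intro B hB
    have h2 := μ.apply_eq_posPart_real_sub_negPart_real hB
    have h3 := ν.apply_eq_posPart_real_sub_negPart_real hB
    have h4 : σ B = μ B - ν B := rfl
    unfold SignedMeasure.totalVariation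
    rw [measureReal_add_apply, measureReal_add_apply, h4, h2, h3, abs_le]
    constructor <;> linarith [measureReal_nonneg (μ := μ.toJordanDecomposition.posPart) (s := B),
      measureReal_nonneg (μ := μ.toJordanDecomposition.negPart) (s := B),
      measureReal_nonneg (μ := ν.toJordanDecomposition.posPart) (s := B),
      measureReal_nonneg (μ := ν.toJordanDecomposition.negPart) (s := B)]
  have approx : ∀ (B : Set L), MeasurableSet B → ∀ ε > 0, ∃ K ⊆ B, IsCompact K ∧
      |σ (B \ K)| ≤ ε := by
    intro B hB ε hε
    have e : ENNReal.ofReal (ε / 2) ≠ 0 := by simpa using hε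
    obtain ⟨K1, hK1, hc1, h1⟩ := hB.exists_isCompact_sdiff_lt (μ := μ.totalVariation)
      (measure_ne_top _ _) e
    obtain ⟨K2, hK2, hc2, h2⟩ := hB.exists_isCompact_sdiff_lt (μ := ν.totalVariation)
      (measure_ne_top _ _) e
    refine ⟨K1 ∪ K2, union_subset hK1 hK2, hc1.union hc2, ?_⟩
    refine (happ _ (hB.diff (hc1.union hc2).measurableSet)).trans ?_
    have a1 : μ.totalVariation.real (B \ (K1 ∪ K2)) ≤ ε / 2 :=
      (measureReal_mono (sdiff_subset_sdiff_right subset_union_left)).trans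
        (ENNReal.toReal_le_of_le_ofReal (by positivity) h1.le)
    have a2 : ν.totalVariation.real (B \ (K1 ∪ K2)) ≤ ε / 2 :=
      (measureReal_mono (sdiff_subset_sdiff_right subset_union_right)).trans
        (ENNReal.toReal_le_of_le_ofReal (by positivity) h2.le)
    linarith
  refine le_of_forall_pos_le_add fun ε hε => ?_
  obtain ⟨K1, hK1, hc1, h1⟩ := approx P hP (ε / 4) (by positivity)
  obtain ⟨K2, hK2, hc2, h2⟩ := approx Pᶜ hP.compl (ε / 4) (by positivity)
  have hdisj : Disjoint K2 K1 := (disjoint_compl_left.mono hK2 hK1)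
  obtain ⟨g, hg0, hg1, hg⟩ := exists_continuous_zero_one_of_isClosed hc2.isClosed hc1.isClosed hdisj
  let f : C(L, ℝ) := 2 * g - 1
  have hf : ∀ x, f x = 2 * g x - 1 := fun x => rfl
  have hfb : ∀ x, |f x| ≤ 1 := by
    intro x
    rw [hf, abs_le]
    constructor <;> linarith [(hg x).1, (hg x).2]
  have hpP : p.real (P \ K1) ≤ ε / 4 := by
    have e1 := σ.apply_eq_posPart_real_sub_negPart_real (hP.diff hc1.measurableSet)
    have e2 : n.real (P \ K1) = 0 := by
      rw [measureReal_def, measure_mono_null sdiff_subset hn]; rfl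
    rw [e2, sub_zero] at e1
    rw [← e1]; exact (le_abs_self _).trans h1
  have hnP : n.real (Pᶜ \ K2) ≤ ε / 4 := by
    have e1 := σ.apply_eq_posPart_real_sub_negPart_real (hP.compl.diff hc2.measurableSet)
    have e2 : p.real (Pᶜ \ K2) = 0 := by
      rw [measureReal_def, measure_mono_null sdiff_subset hp]; rfl
    rw [e2, zero_sub] at e1
    have := (neg_le_abs _).trans h2
    rw [e1, neg_neg] at this; exact this
  have hp1 : p.real K1ᶜ ≤ ε / 4 := by
    refine le_trans ?_ hpP
    have : K1ᶜ ⊆ (P \ K1) ∪ Pᶜ := by intro x hx; by_cases hxP : x ∈ P <;> simp_all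
    refine (measureReal_mono this).trans ((measureReal_union_le _ _).trans ?_)
    simp [measureReal_def, hp]
  have hn1 : n.real K2ᶜ ≤ ε / 4 := by
    refine le_trans ?_ hnP
    have : K2ᶜ ⊆ (Pᶜ \ K2) ∪ P := by intro x hx; by_cases hxP : x ∈ P <;> simp_all
    refine (measureReal_mono this).trans ((measureReal_union_le _ _).trans ?_)
    simp [measureReal_def, hn]
  have hpi : p.real univ - ε / 2 ≤ ∫ x, f x ∂p := by
    have : ∫ x, (1 - 2 * K1ᶜ.indicator (fun _ => (1:ℝ)) x) ∂p ≤ ∫ x, f x ∂p := by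
      refine integral_mono ?_ (f.integrable_of_isFiniteMeasure p) ?_
      · exact (integrable_const _).sub
          (((integrable_const (1:ℝ)).indicator hc1.measurableSet.compl).const_mul 2)
      · intro x
        by_cases hx : x ∈ K1
        · simp [hx, hf, hg1 hx]; norm_num
        · simp [hx]; linarith [(abs_le.1 (hfb x)).1]
    rw [integral_sub (integrable_const _)
      (((integrable_const (1:ℝ)).indicator hc1.measurableSet.compl).const_mul 2),
      integral_const_mul, integral_indicator_const _ hc1.measurableSet.compl] at this
    simp at this
    linarith
  have hni : ∫ x, f x ∂n ≤ - n.real univ + ε / 2 := by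
    have : ∫ x, f x ∂n ≤ ∫ x, (-1 + 2 * K2ᶜ.indicator (fun _ => (1:ℝ)) x) ∂n := by
      refine integral_mono (f.integrable_of_isFiniteMeasure n) ?_ ?_
      · exact (integrable_const _).add
          (((integrable_const (1:ℝ)).indicator hc2.measurableSet.compl).const_mul 2)
      · intro x
        by_cases hx : x ∈ K2
        · simp [hx, hf, hg0 hx]
        · simp [hx]; linarith [(abs_le.1 (hfb x)).2]
    rw [integral_add (integrable_const _)
      (((integrable_const (1:ℝ)).indicator hc2.measurableSet.compl).const_mul 2),
      integral_const_mul, integral_indicator_const _ hc2.measurableSet.compl] at this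
    simp at this
    linarith
  have htot : tvNorm σ = p.real univ + n.real univ := by
    unfold tvNorm SignedMeasure.totalVariation
    exact measureReal_add_apply
  have := (le_abs_self _).trans (h f hfb)
  unfold integ at this
  rw [htot]
  linarith

/-- A countably supported regular signed measure is approximated in norm by finitely supported
ones. -/
theorem exists_finsupp_approx {μ : SignedMeasure L} (hμ : IsRadon μ)
    (hs : (msupport μ).Countable) {ε : ℝ} (hε : 0 < ε) :
    ∃ η : L →₀ ℝ, ∀ f : C(L, ℝ), |integ μ f - pair η f| ≤ ε * ‖f‖ := by
  classical
  obtain ⟨T, hT⟩ := exists_finset_compl_small hμ hs hε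
  set p := μ.toJordanDecomposition.posPart with hp
  set n := μ.toJordanDecomposition.negPart with hn
  refine ⟨Finsupp.onFinset T (fun x => if x ∈ T then p.real {x} - n.real {x} else 0)
    (by intro x hx; by_contra h; simp [h] at hx), fun f => ?_⟩
  have hpair : pair (Finsupp.onFinset T (fun x => if x ∈ T then p.real {x} - n.real {x} else 0)
      (by intro x hx; by_contra h; simp [h] at hx)) f
      = ∑ x ∈ T, (p.real {x} - n.real {x}) * f x := by
    unfold pair
    rw [Finset.sum_subset Finsupp.support_onFinset_subset]
    · refine Finset.sum_congr rfl fun x hx => ?_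
      simp [hx]
    · intro x hx h
      rw [Finsupp.notMem_support_iff.1 h, zero_mul]
  have split : ∀ (α : Measure L) [IsFiniteMeasure α], ∃ r : ℝ, |r| ≤ α.real (T : Set L)ᶜ * ‖f‖ ∧
      ∫ x, f x ∂α = ∑ x ∈ T, α.real {x} * f x + r := by
    intro α _
    refine ⟨∫ x in (T : Set L)ᶜ, f x ∂α, ?_, ?_⟩
    · have := norm_setIntegral_le_of_norm_le_const (μ := α) (s := (T : Set L)ᶜ) (f := f)
        (C := ‖f‖) (measure_lt_top _ _) (fun x _ => f.norm_coe_le_norm x)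
      rwa [mul_comm] at this
    · rw [← integral_add_compl T.measurableSet (f.integrable_of_isFiniteMeasure α),
        setIntegral_finset]
      · simp
      · exact (f.integrable_of_isFiniteMeasure α).integrableOn
  obtain ⟨r1, h1, e1⟩ := split p
  obtain ⟨r2, h2, e2⟩ := split n
  have htot : μ.totalVariation.real (T : Set L)ᶜ = p.real (T : Set L)ᶜ + n.real (T : Set L)ᶜ :=
    measureReal_add_apply
  rw [hpair]
  unfold integ
  rw [← hp, ← hn, e1, e2]
  have : ∑ x ∈ T, (p.real {x} - n.real {x}) * f x
      = ∑ x ∈ T, p.real {x} * f x - ∑ x ∈ T, n.real {x} * f x := by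
    rw [← Finset.sum_sub_distrib]
    exact Finset.sum_congr rfl fun x _ => by ring
  rw [this]
  have hb := mul_le_mul_of_nonneg_right hT (norm_nonneg f)
  rw [htot, add_mul] at hb
  rw [abs_le] at *
  constructor <;> linarith

theorem ell1Grothendieck_of_finSchur (h : FinSchur L) : Ell1Grothendieck L := by
  intro μs μ hμs hc hμ hlim φ hφ
  obtain ⟨C, hC⟩ := hφ
  choose η hη using fun n =>
    exists_finsupp_approx (hμs n) (hc n) (Nat.one_div_pos_of_nat (n := n) (α := ℝ))
  have hη0 : ∀ f : C(L, ℝ), Tendsto (fun n => pair (η n) f) atTop (𝓝 (integ μ f)) := by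
    intro f
    have h1 : Tendsto (fun n => integ (μs n) f - pair (η n) f) atTop (𝓝 0) := by
      refine squeeze_zero_norm (fun n => hη n f) ?_
      simpa using (tendsto_one_div_add_atTop_nhds_zero_nat (𝕜 := ℝ)).mul_const ‖f‖
    simpa using (hlim f).sub h1
  have cauchy : ∀ ε > 0, ∃ N, ∀ n ≥ N, ∀ m ≥ N, mass (η n - η m) univ ≤ ε := by
    by_contra! hcon
    obtain ⟨ε, hε, hcon⟩ := hcon
    choose n hn m hm hnm using hcon
    have hn' := tendsto_atTop_mono hn tendsto_id
    have hm' := tendsto_atTop_mono hm tendsto_id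
    have := h (fun N => η (n N) - η (m N)) fun f => by
      simpa [pair_sub] using ((hη0 f).comp hn').sub ((hη0 f).comp hm')
    obtain ⟨N, hN⟩ := (this.eventually_lt_const hε).exists
    exact lt_asymm hN (hnm N)
  have htv : Tendsto (fun n => tvNorm (μs n - μ)) atTop (𝓝 0) := by
    rw [Metric.tendsto_atTop]
    intro ε hε
    obtain ⟨N, hN⟩ := cauchy (ε / 4) (by positivity)
    obtain ⟨N', hN'⟩ := ((tendsto_one_div_add_atTop_nhds_zero_nat (𝕜 := ℝ)).eventually_lt_const
      (show 0 < ε / 4 by positivity)).exists_forall_of_atTop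
    refine ⟨max N N', fun n hn => ?_⟩
    rw [Real.dist_0_eq_abs, abs_of_nonneg (show 0 ≤ tvNorm _ from ENNReal.toReal_nonneg)]
    refine (tvNorm_le_of_forall_integ_le (hμs n) hμ (c := 3 * (ε / 4)) fun f hf => ?_).trans_lt
      (by linarith)
    rw [integ_sub]
    have hf1 : ‖f‖ ≤ 1 := (ContinuousMap.norm_le _ zero_le_one).2 hf
    have happ : ∀ m ≥ N', |integ (μs m) f - pair (η m) f| ≤ ε / 4 := fun m hm =>
      (hη m f).trans ((mul_le_of_le_one_right (by positivity) hf1).trans (hN' m hm).le)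
    refine le_of_tendsto ((tendsto_const_nhds.sub (hlim f)).abs) ?_
    filter_upwards [eventually_ge_atTop (max N N')] with m hm
    have h1 := happ n ((le_max_right _ _).trans hn)
    have h2 := happ m ((le_max_right _ _).trans hm)
    have h3 := (abs_pair_le_mass (η n - η m) hf).trans
      (hN n ((le_max_left _ _).trans hn) m ((le_max_left _ _).trans hm))
    rw [pair_sub] at h3
    rw [abs_le] at *
    constructor <;> linarith
  rw [← tendsto_sub_nhds_zero_iff]
  refine squeeze_zero_norm (fun n => ?_) (by simpa using htv.const_mul C)
  rw [← map_sub]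
  exact hC _

end SignedMeasures

section Disjointification

variable {L : Type*} [TopologicalSpace L]

theorem WNull.tendsto_chg {θ : ℕ → L →₀ ℝ} (h : WNull θ) {V : Set L} (hV : IsClopen V) :
    Tendsto (fun j => chg (θ j) V) atTop (𝓝 0) :=
  h ⟨V.indicator 1, hV.continuous_indicator continuous_one⟩

variable [CompactSpace L] [T2Space L] [TotallyDisconnectedSpace L]

/-- Inside every clopen set some clopen subset carries a charge of at least half of the mass. -/
theorem exists_clopen_mass_le_chg (η : L →₀ ℝ) {V : Set L} (hV : IsClopen V) :
    ∃ V' ⊆ V, IsClopen V' ∧ mass η V ≤ 2 * |chg η V'| := by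
  classical
  have hsep : ∀ P N : Finset L, (P : Set L) ⊆ V → Disjoint P N →
      ∃ V' ⊆ V, IsClopen V' ∧ (P : Set L) ⊆ V' ∧ Disjoint V' N := by
    intro P N hP hPN
    obtain ⟨C, hC, h1, h2⟩ := exists_clopen_of_closed_subset_open P.finite_toSet.isClosed
      (hV.isOpen.sdiff N.finite_toSet.isClosed)
      (show (P : Set L) ⊆ V \ N from
        subset_sdiff.2 ⟨hP, Finset.disjoint_coe.2 hPN⟩)
    exact ⟨C, h2.trans sdiff_subset, hC, h1, disjoint_sdiff_left.mono_left h2⟩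
  set P := η.support.filter (fun x => x ∈ V ∧ 0 < η x) with hP
  set N := η.support.filter (fun x => x ∈ V ∧ η x < 0) with hN
  have hPN : Disjoint P N := Finset.disjoint_filter.2 fun x _ h1 h2 => lt_asymm h1.2 h2.2
  have hmass : mass η V = chg η P - chg η N := by
    unfold mass chg pair
    rw [← Finset.sum_sub_distrib]
    refine Finset.sum_congr rfl fun x hx => ?_
    have hx0 := Finsupp.mem_support_iff.1 hx
    by_cases hxV : x ∈ V
    · rcases lt_or_gt_of_ne hx0 with h | h
      · simp [hxV, hP, hN, abs_of_neg h, h, hx0, h.not_gt]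
      · simp [hxV, hP, hN, abs_of_pos h, h, hx0, h.not_gt]
    · simp [hxV, hP, hN]
  have hPV : (P : Set L) ⊆ V := fun x hx => (Finset.mem_filter.1 hx).2.1
  have hNV : (N : Set L) ⊆ V := fun x hx => (Finset.mem_filter.1 hx).2.1
  obtain ⟨V1, h1, hc1, hP1, hN1⟩ := hsep P N hPV hPN
  obtain ⟨V2, h2, hc2, hN2, hP2⟩ := hsep N P hNV hPN.symm
  have key : ∀ x ∈ η.support, x ∈ V → x ∈ P ∨ x ∈ N := by
    intro x hx hxV
    rcases lt_or_gt_of_ne (Finsupp.mem_support_iff.1 hx) with h | h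
    · exact Or.inr (Finset.mem_filter.2 ⟨hx, hxV, h⟩)
    · exact Or.inl (Finset.mem_filter.2 ⟨hx, hxV, h⟩)
  have e1 : chg η V1 = chg η P := chg_congr fun x hx =>
    ⟨fun h => (key x hx (h1 h)).resolve_right fun h' => disjoint_left.1 hN1 h h', fun h => hP1 h⟩
  have e2 : chg η V2 = chg η N := chg_congr fun x hx =>
    ⟨fun h => (key x hx (h2 h)).resolve_left fun h' => disjoint_left.1 hP2 h h', fun h => hN2 h⟩
  rcases le_total (mass η V) (2 * |chg η V1|) with h | h
  · exact ⟨V1, h1, hc1, h⟩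
  · refine ⟨V2, h2, hc2, ?_⟩
    rw [e1] at h
    rw [e2]
    have := le_abs_self (chg η P)
    have := neg_le_abs (chg η N)
    linarith

theorem WNull.exists_bound {θ : ℕ → L →₀ ℝ} (h : WNull θ) : ∃ B, ∀ j, mass (θ j) univ ≤ B := by
  let g : ℕ → C(L, ℝ) →L[ℝ] ℝ := fun j =>
    ∑ x ∈ (θ j).support, θ j x • ContinuousMap.evalCLM ℝ x
  have hg : ∀ j f, g j f = pair (θ j) f := by
    intro j f
    simp [g, pair, ContinuousMap.evalCLM]
  obtain ⟨C, hC⟩ := banach_steinhaus (g := g) fun f => by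
    obtain ⟨C, hC⟩ := (h f).norm.bddAbove_range
    exact ⟨C, fun i => by rw [hg]; exact hC ⟨i, rfl⟩⟩
  refine ⟨2 * C, fun j => ?_⟩
  obtain ⟨V, -, hV, hVm⟩ := exists_clopen_mass_le_chg (θ j) isClopen_univ
  have h1 := (g j).le_opNorm ⟨V.indicator 1, hV.continuous_indicator continuous_one⟩
  rw [hg] at h1
  have h2 : ‖(⟨V.indicator 1, hV.continuous_indicator continuous_one⟩ : C(L, ℝ))‖ ≤ 1 := by
    refine (ContinuousMap.norm_le _ zero_le_one).2 fun x => ?_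
    by_cases hx : x ∈ V <;> simp [hx]
  have h3 : |chg (θ j) V| ≤ ‖g j‖ * 1 := h1.trans (by gcongr)
  linarith [hC j]

/-- No weak* null sequence of finitely supported measures has charges bounded away from zero along
a sequence of disjoint clopen sets. -/
def NoDisjointCharges (X : Type*) [TopologicalSpace X] : Prop :=
  ∀ θ : ℕ → X →₀ ℝ, WNull θ → ∀ W : ℕ → Set X, (∀ k, IsClopen (W k)) →
    (∀ k l, k < l → Disjoint (W k) (W l)) → ∀ δ > 0, ¬ ∀ k, δ ≤ |chg (θ k) (W k)|

theorem WNull.tendsto_apply (H : NoDisjointCharges L) {θ : ℕ → L →₀ ℝ} (h : WNull θ) (x : L) :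
    Tendsto (fun j => θ j x) atTop (𝓝 0) := by
  classical
  rw [Metric.tendsto_atTop]
  by_contra! hcon
  obtain ⟨δ, hδ, hcon⟩ := hcon
  obtain ⟨f, hf, hr⟩ := exists_seq_of_forall_finset_exists
    (fun p : ℕ × Set L => IsClopen p.2 ∧ x ∈ p.2 ∧ (∀ y ∈ (θ p.1).support, y ∈ p.2 → y = x) ∧
      δ ≤ |θ p.1 x|)
    (fun p q => p.1 < q.1 ∧ q.2 ⊆ p.2 ∧ |chg (θ q.1) p.2| < δ / 2) (by
      intro s hs
      have hev : ∀ᶠ j in atTop, ∀ p ∈ s, p.1 < j ∧ |chg (θ j) p.2| < δ / 2 := by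
        rw [Filter.eventually_all_finset]
        intro p hp
        refine (eventually_gt_atTop p.1).and ?_
        have := (h.tendsto_chg (hs p hp).1).abs
        rw [abs_zero] at this
        exact this.eventually_lt_const (by positivity)
      obtain ⟨N, hN⟩ := hev.exists_forall_of_atTop
      obtain ⟨j, hj, hjx⟩ := hcon N
      have hopen : IsOpen ((⋂ p ∈ s, p.2) \ ((θ j).support.erase x : Finset L)) :=
        (isOpen_biInter_finset fun p hp => (hs p hp).1.isOpen).sdiff
          (Finset.finite_toSet _).isClosed
      obtain ⟨O, hO, hxO, hOs⟩ := exists_clopen_of_closed_subset_open (isClosed_singleton (x := x))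
        hopen (by simpa using fun a b hp => (hs (a, b) hp).2.1)
      refine ⟨(j, O), ⟨hO, hxO rfl, fun y hy hyO => ?_, by simpa using hjx⟩, fun p hp =>
        ⟨(hN j hj p hp).1, fun y hy => mem_iInter₂.1 (hOs hy).1 p hp, (hN j hj p hp).2⟩⟩
      by_contra hne
      exact (hOs hyO).2 (by simp [hne] at hy ⊢; exact hy))
  refine H (fun k => θ (f (k + 1)).1) (h.comp (tendsto_add_atTop_iff_nat 1 |>.2
    (strictMono_nat_of_lt_succ fun k => (hr k (k + 1) k.lt_succ_self).1).tendsto_atTop))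
    (fun k => (f k).2 \ (f (k + 1)).2) (fun k => (hf k).1.diff (hf (k + 1)).1) ?_ (δ / 2)
    (by positivity) ?_
  · intro k l hkl
    have : (f l).2 ⊆ (f (k + 1)).2 := by
      rcases (Nat.succ_le_of_lt hkl).eq_or_lt with e | e
      · rw [← e]
      · exact (hr _ _ e).2.1
    exact disjoint_sdiff_left.mono_right (sdiff_subset.trans this)
  · intro k
    have h1 := chg_sdiff_add_inter (θ (f (k + 1)).1) (f k).2 (f (k + 1)).2
    rw [inter_eq_right.2 (hr k (k + 1) k.lt_succ_self).2.1] at h1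
    have h2 := (hr k (k + 1) k.lt_succ_self).2.2
    obtain ⟨-, hx1, hx2, hx3⟩ := hf (k + 1)
    have h3 : chg (θ (f (k + 1)).1) (f (k + 1)).2 = θ (f (k + 1)).1 x := by
      have hx0 : θ (f (k + 1)).1 x ≠ 0 := fun h0 => by
        rw [h0, abs_zero] at hx3
        linarith
      unfold chg pair
      rw [Finset.sum_eq_single x]
      · simp [hx1]
      · intro y hy hyx
        rw [indicator_of_notMem fun hyO => hyx (hx2 y hy hyO), mul_zero]
      · intro hx
        exact absurd (Finsupp.mem_support_iff.2 hx0) hx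
    rw [← h3] at hx3
    rw [← h1] at h2
    set a := chg (θ (f (k + 1)).1) ((f k).2 \ (f (k + 1)).2)
    set c := chg (θ (f (k + 1)).1) (f (k + 1)).2
    have h4 := abs_sub (a + c) a
    rw [add_sub_cancel_left] at h4
    change δ / 2 ≤ |a|
    linarith

/-- Outside a finite set, every finite set has a clopen neighbourhood of small mass along an
ultrafilter. -/
theorem exists_finset_forall_small_nhds {θ : ℕ → L →₀ ℝ} {B : ℝ} (hB : ∀ j, mass (θ j) univ ≤ B)
    (𝒰 : Ultrafilter ℕ) {d : ℝ} (hd : 0 < d) :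
    ∃ Q : Finset L, ∀ T : Finset L, Disjoint T Q →
      ∃ V, IsClopen V ∧ (T : Set L) ⊆ V ∧ ∀ᶠ i in 𝒰, mass (θ i) V < d := by
  classical
  by_contra! hcon
  obtain ⟨T, hT, hdisj⟩ := exists_seq_of_forall_finset_exists
    (fun T : Finset L => ∀ V, IsClopen V → (T : Set L) ⊆ V → ∀ᶠ i in 𝒰, d ≤ mass (θ i) V)
    (fun T T' => Disjoint T T') (by
      intro s _
      obtain ⟨T, hT, hV⟩ := hcon (s.biUnion id)
      exact ⟨T, hV, fun S hS => (hT.mono_right (Finset.subset_biUnion_of_mem id hS)).symm⟩)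
  obtain ⟨M, hM⟩ := exists_nat_gt (B / d)
  obtain ⟨C, hC, hTC, -, -, hCd⟩ := exists_clopen_partition_of_clopen_cover
    (I := Fin M) (Z := fun i => (T i : Set L)) (D := fun _ => univ)
    (fun i => (T i).finite_toSet.isClosed) (fun _ => isClopen_univ) (fun _ => subset_univ _)
    (fun i _ j _ hij => by
      refine Finset.disjoint_coe.2 ?_
      rcases lt_or_gt_of_ne (Fin.val_ne_of_ne hij) with h | h
      · exact hdisj _ _ h
      · exact (hdisj _ _ h).symm)
  have hev : ∀ᶠ i in 𝒰, ∀ k, d ≤ mass (θ i) (C k) :=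
    eventually_all.2 fun k => hT k _ (hC k) (hTC k)
  obtain ⟨i, hi⟩ := hev.exists
  have h1 := sum_mass_le (θ i) Finset.univ (V := C) (by simpa using hCd)
  have h2 : ∑ k : Fin M, d ≤ ∑ k, mass (θ i) (C k) := Finset.sum_le_sum fun k _ => hi k
  rw [div_lt_iff₀ hd] at hM
  simp at h2
  linarith [hB i]

theorem finSchur_of_noDisjointCharges (H : NoDisjointCharges L) : FinSchur L := by
  classical
  intro θ' h'
  rw [Metric.tendsto_atTop]
  by_contra! hcon
  obtain ⟨ε, hε, hcon⟩ := hcon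
  obtain ⟨n, hn, hnε⟩ := extraction_of_frequently_atTop
    (P := fun j => ε ≤ mass (θ' j) univ) (by
      rw [frequently_atTop]
      intro N
      obtain ⟨j, hj, hj'⟩ := hcon N
      rw [Real.dist_0_eq_abs, abs_of_nonneg (mass_nonneg _ _)] at hj'
      exact ⟨j, hj, hj'⟩)
  set θ := fun j => θ' (n j) with hθ
  have h : WNull θ := h'.comp hn.tendsto_atTop
  obtain ⟨B, hB⟩ := h.exists_bound
  set 𝒰 := hyperfilter ℕ
  set δ := ε / 10 with hδ
  have hδ0 : 0 < δ := by positivity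
  obtain ⟨f, hf, hr⟩ := exists_seq_of_forall_finset_exists
    (fun p : ℕ × Set L × ℝ => IsClopen p.2.1 ∧ 0 < p.2.2 ∧ p.2.2 ≤ δ ∧
      4 * δ ≤ |chg (θ p.1) p.2.1| ∧ ∀ᶠ i in 𝒰, mass (θ i) p.2.1 < p.2.2)
    (fun p q => p.1 < q.1 ∧ mass (θ q.1) p.2.1 < p.2.2 ∧ q.2.2 ≤ p.2.2 / 2) (by
      intro s hs
      obtain ⟨d, hds, hd⟩ : ∃ d : ℝ, (∀ p ∈ s, d ≤ p.2.2 / 2) ∧ 0 < d ∧ d ≤ δ := by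
        have : ∀ᶠ d in 𝓝[>] (0 : ℝ), (∀ p ∈ s, d ≤ p.2.2 / 2) ∧ d ∈ Ioc 0 δ := by
          refine ((eventually_all_finset s).2 fun p hp => ?_).and (Ioc_mem_nhdsGT hδ0)
          filter_upwards [Ioc_mem_nhdsGT (half_pos (hs p hp).2.1)] with d hd using hd.2
        exact this.exists
      obtain ⟨Q, hQ⟩ := exists_finset_forall_small_nhds hB 𝒰 hd.1
      have hQ0 : Tendsto (fun j => mass (θ j) Q) atTop (𝓝 0) := by
        simp_rw [mass_coe_finset]
        simpa using tendsto_finsetSum Q fun x _ => (h.tendsto_apply H x).abs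
      have hev : ∀ᶠ j in 𝒰, (∀ p ∈ s, p.1 < j ∧ mass (θ j) p.2.1 < p.2.2) ∧
          mass (θ j) Q < δ := by
        refine ((eventually_all_finset s).2 fun p hp => ?_).and
          (Nat.hyperfilter_le_atTop (hQ0.eventually_lt_const hδ0))
        have hgt : ∀ᶠ j in 𝒰, p.1 < j := Nat.hyperfilter_le_atTop (eventually_gt_atTop p.1)
        exact hgt.and (hs p hp).2.2.2.2
      obtain ⟨j, hj, hjQ⟩ := hev.exists
      obtain ⟨V, hV, hTV, hVd⟩ := hQ ((θ j).support \ Q) Finset.sdiff_disjoint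
      obtain ⟨V', hV'V, hV', hm⟩ := exists_clopen_mass_le_chg (θ j) hV
      refine ⟨(j, V', d), ⟨hV', hd.1, hd.2, ?_, ?_⟩, fun p hp =>
        ⟨(hj p hp).1, (hj p hp).2, hds p hp⟩⟩
      · have h1 : mass (θ j) univ ≤ mass (θ j) V + mass (θ j) Q := by
          refine le_trans (Finset.sum_le_sum fun x hx => ?_) (mass_union_le (θ j) V Q)
          have : x ∈ V ∪ Q := by
            by_cases hxQ : x ∈ Q
            · exact Or.inr hxQ
            · exact Or.inl (hTV (by simpa using ⟨by simpa using hx, hxQ⟩))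
          simp [this]
        have h2 : ε ≤ mass (θ j) univ := hnε j
        dsimp only
        linarith
      · filter_upwards [hVd] with i hi
        exact (mass_mono _ hV'V).trans_lt hi)
  have hsmall : ∀ k, (f k).2.2 ≤ δ * (1 / 2) ^ k := by
    intro k
    induction k with
    | zero => simpa using (hf 0).2.2.1
    | succ k ih =>
      have := (hr k (k + 1) k.lt_succ_self).2.2
      rw [pow_succ]
      linarith
  refine H (fun k => θ (f k).1) (h.comp (strictMono_nat_of_lt_succ fun k =>
    (hr k (k + 1) k.lt_succ_self).1).tendsto_atTop)
    (fun k => (f k).2.1 \ ⋃ i ∈ Finset.range k, (f i).2.1)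
    (fun k => (hf k).1.diff (Finset.finite_toSet _ |>.isClopen_biUnion fun i _ => (hf i).1)) ?_
    δ hδ0 ?_
  · intro k l hkl
    refine disjoint_sdiff_right.mono sdiff_subset (sdiff_subset_sdiff_right ?_)
    exact subset_biUnion_of_mem (u := fun i => (f i).2.1) (by simpa using hkl)
  · intro k
    have h1 := chg_sdiff_add_inter (θ (f k).1) (f k).2.1 (⋃ i ∈ Finset.range k, (f i).2.1)
    have h2 := (abs_chg_le_mass (θ (f k).1) _).trans ((mass_mono _ (inter_subset_right
      (s := (f k).2.1) (t := ⋃ i ∈ Finset.range k, (f i).2.1))).trans (mass_biUnion_le _ _ _))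
    have h3 : ∑ i ∈ Finset.range k, mass (θ (f k).1) (f i).2.1 ≤ 2 * δ := by
      refine (Finset.sum_le_sum fun i hi =>
        ((hr i k (Finset.mem_range.1 hi)).2.1.le.trans (hsmall i))).trans ?_
      rw [← Finset.mul_sum]
      have := sum_geometric_two_le k
      nlinarith
    have h4 := (hf k).2.2.2.1
    rw [← h1] at h4
    have h5 := h4.trans (abs_add_le _ _)
    linarith

end Disjointification
/-- Rosenthal's lemma. -/
theorem exists_infinite_forall_sdiff_lt {m : ℕ → Set ℕ → ℝ} {B ε : ℝ} (hε : 0 < ε)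
    (h0 : ∀ k S, 0 ≤ m k S)
    (hadd : ∀ k S T, Disjoint S T → m k S + m k T ≤ m k (S ∪ T)) (hB : ∀ k, m k univ ≤ B) :
    ∃ S : Set ℕ, S.Infinite ∧ ∀ k ∈ S, m k (S \ {k}) < ε := by
  have hmono : ∀ k S T, S ⊆ T → m k S ≤ m k T := by
    intro k S T hST
    have := hadd k S (T \ S) disjoint_sdiff_right
    rw [union_sdiff_cancel hST] at this
    linarith [h0 k (T \ S)]
  have key : ∀ (n : ℕ) (S : Set ℕ), S.Infinite → (∀ k ∈ S, m k (S \ {k}) < n * ε) →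
      ∃ S : Set ℕ, S.Infinite ∧ ∀ k ∈ S, m k (S \ {k}) < ε := by
    intro n
    induction n with
    | zero =>
      intro S hS h
      obtain ⟨k, hk⟩ := hS.nonempty
      have := h k hk
      simp only [CharP.cast_eq_zero, zero_mul] at this
      exact absurd this (h0 _ _).not_gt
    | succ n ih =>
      intro S hS h
      let e : ℕ → ℕ := fun i => (hS.natEmbedding S i : ℕ)
      have he : Function.Injective e := fun i j hij =>
        (hS.natEmbedding S).injective (Subtype.ext hij)
      have heS : ∀ i, e i ∈ S := fun i => (hS.natEmbedding S i).2
      let P : ℕ → Set ℕ := fun i => range fun j => e (Nat.pair i j)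
      have hP : ∀ i, (P i).Infinite := fun i =>
        infinite_range_of_injective fun j j' hj => (Nat.pair_eq_pair.1 (he hj)).2
      by_cases hc : ∃ i, ∀ k ∈ P i, m k (P i \ {k}) < ε
      · obtain ⟨i, hi⟩ := hc
        exact ⟨P i, hP i, hi⟩
      push Not at hc
      choose k hkP hk using hc
      have hinj : ∀ i i', k i ∈ P i' → i = i' := by
        intro i i' h'
        obtain ⟨j, hj⟩ := hkP i
        obtain ⟨j', hj'⟩ := h'
        exact (Nat.pair_eq_pair.1 (he (hj.trans hj'.symm))).1
      have hkS : ∀ i, k i ∈ S := by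
        intro i
        obtain ⟨j, hj⟩ := hkP i
        rw [← hj]
        exact heS _
      refine ih (range k) (infinite_range_of_injective fun i i' hi =>
        hinj i i' (hi ▸ hkP i')) ?_
      rintro _ ⟨i, rfl⟩
      have hd : Disjoint (P i \ {k i}) (range k \ {k i}) := by
        rw [disjoint_left]
        rintro _ ⟨hx, -⟩ ⟨⟨i', rfl⟩, hne⟩
        exact hne (by rw [hinj i' i hx]; rfl)
      have h1 := hadd (k i) _ _ hd
      have h2 : m (k i) (P i \ {k i} ∪ range k \ {k i}) ≤ m (k i) (S \ {k i}) := by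
        refine hmono _ _ _ (union_subset (sdiff_subset_sdiff_left ?_)
          (sdiff_subset_sdiff_left ?_))
        · rintro _ ⟨j, rfl⟩
          exact heS _
        · rintro _ ⟨j, rfl⟩
          exact hkS _
      have h3 := h (k i) (hkS i)
      have h4 := hk i
      push_cast at h3
      linarith
  obtain ⟨n, hn⟩ := exists_nat_gt (B / ε)
  rw [div_lt_iff₀ hε] at hn
  exact key n univ infinite_univ fun k _ =>
    (hmono k _ _ (subset_univ _)).trans_lt ((hB k).trans_lt hn)

/-- A weak* null sequence of finitely supported measures cannot have charges bounded away from zero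
along disjoint sets all of whose unions are contained in suitable clopen sets. -/
theorem WNull.not_forall_le_abs_chg {L : Type*} [TopologicalSpace L] {θ : ℕ → L →₀ ℝ}
    (h : WNull θ) {B : ℝ} (hB : ∀ j, mass (θ j) univ ≤ B) (V : Set ℕ → Set L)
    (hV : ∀ S, IsClopen (V S)) (hunion : ∀ S T, V (S ∪ T) = V S ∪ V T)
    (hdisj : ∀ S T, Disjoint S T → Disjoint (V S) (V T)) {δ : ℝ} (hδ : 0 < δ) :
    ¬ ∀ k, δ ≤ |chg (θ k) (V {k})| := by
  intro hcon
  obtain ⟨S, hS, hSδ⟩ := exists_infinite_forall_sdiff_lt (m := fun k S => mass (θ k) (V S))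
    (ε := δ / 2) (half_pos hδ) (fun k S => mass_nonneg _ _)
    (fun k S T hST => by rw [hunion, mass_union _ (hdisj _ _ hST)])
    (fun k => (mass_mono _ (subset_univ _)).trans (hB k))
  have hlim := (h.tendsto_chg (hV S)).abs
  rw [abs_zero] at hlim
  obtain ⟨N, hN⟩ := (hlim.eventually_lt_const (half_pos hδ)).exists_forall_of_atTop
  obtain ⟨k, hkS, hk⟩ := hS.exists_gt N
  have h1 : chg (θ k) (V S) = chg (θ k) (V {k}) + chg (θ k) (V (S \ {k})) := by
    rw [← chg_union _ (hdisj _ _ disjoint_sdiff_right), ← hunion, union_sdiff_cancel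
      (singleton_subset_iff.2 hkS)]
  have h2 := (abs_chg_le_mass (θ k) _).trans_lt (hSδ k hkS)
  have h3 := hN k hk.le
  have h4 := abs_sub (chg (θ k) (V S)) (chg (θ k) (V (S \ {k})))
  rw [h1, add_sub_cancel_right, ← h1] at h4
  linarith [hcon k]

section Space

/-- A submeasure on `ℕ` taking arbitrarily small values on residue classes. -/
structure IsDiffuseSubmeasure (d : Set ℕ → ℝ≥0∞) : Prop where
  empty : d ∅ = 0
  mono : ∀ {A B}, A ⊆ B → d A ≤ d B
  union_le : ∀ A B, d (A ∪ B) ≤ d A + d B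
  univ_ne_top : d univ ≠ ⊤
  exists_modulus : ∀ e, e ≠ 0 → ∃ M, 0 < M ∧ ∀ r, d {i | i % M = r} ≤ e

/-- The sum over all rows of the submeasures of the rows of `C`. -/
noncomputable def weight (d : Set ℕ → ℝ≥0∞) (C : Set (ℕ × ℕ)) : ℝ≥0∞ :=
  ∑' n, d {i | (n, i) ∈ C}

/-- The points of `ℕ × ℕ` whose two copies are separated by `A`. -/
def twist (A : Set ((ℕ × ℕ) × Bool)) : Set (ℕ × ℕ) := {p | ¬((p, false) ∈ A ↔ (p, true) ∈ A)}

/-- The Boolean algebra of sets that separate the two copies only on a set of finite weight. -/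
def alg (d : Set ℕ → ℝ≥0∞) : Set (Set ((ℕ × ℕ) × Bool)) := {A | weight d (twist A) < ⊤}

/-- One of the two copies of a set. -/
def copy (C : Set (ℕ × ℕ)) (b : Bool) : Set ((ℕ × ℕ) × Bool) := {q | q.1 ∈ C ∧ q.2 = b}

variable {d : Set ℕ → ℝ≥0∞}

theorem IsDiffuseSubmeasure.weight_mono (hd : IsDiffuseSubmeasure d)
    {C D : Set (ℕ × ℕ)} (h : C ⊆ D) :
    weight d C ≤ weight d D :=
  ENNReal.tsum_le_tsum fun _ => hd.mono fun _ hi => h hi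

theorem IsDiffuseSubmeasure.weight_union_le (hd : IsDiffuseSubmeasure d) (C D : Set (ℕ × ℕ)) :
    weight d (C ∪ D) ≤ weight d C + weight d D := by
  unfold weight
  rw [← ENNReal.tsum_add]
  exact ENNReal.tsum_le_tsum fun n => hd.union_le {i | (n, i) ∈ C} {i | (n, i) ∈ D}

theorem IsDiffuseSubmeasure.weight_empty (hd : IsDiffuseSubmeasure d) : weight d ∅ = 0 := by
  simp [weight, hd.empty]

theorem IsDiffuseSubmeasure.compl_mem_alg (hd : IsDiffuseSubmeasure d)
    {A} (hA : A ∈ alg d) : Aᶜ ∈ alg d := by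
  refine (hd.weight_mono fun p hp => ?_).trans_lt hA
  simp only [twist, mem_compl_iff, mem_ofPred_eq] at hp ⊢
  tauto

theorem IsDiffuseSubmeasure.union_mem_alg (hd : IsDiffuseSubmeasure d)
    {A B} (hA : A ∈ alg d) (hB : B ∈ alg d) :
    A ∪ B ∈ alg d := by
  refine ((hd.weight_mono (D := twist A ∪ twist B) fun p hp => ?_).trans
    (hd.weight_union_le _ _)).trans_lt (ENNReal.add_lt_top.2 ⟨hA, hB⟩)
  simp only [twist, mem_union, mem_ofPred_eq] at hp ⊢
  tauto

theorem IsDiffuseSubmeasure.inter_mem_alg (hd : IsDiffuseSubmeasure d)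
    {A B} (hA : A ∈ alg d) (hB : B ∈ alg d) :
    A ∩ B ∈ alg d := by
  rw [← compl_compl (A ∩ B), compl_inter]
  exact hd.compl_mem_alg (hd.union_mem_alg (hd.compl_mem_alg hA) (hd.compl_mem_alg hB))

theorem IsDiffuseSubmeasure.copy_mem_alg (hd : IsDiffuseSubmeasure d)
    {C} (hC : weight d C < ⊤) (b : Bool) :
    copy C b ∈ alg d := by
  refine (hd.weight_mono fun p hp => ?_).trans_lt hC
  simp only [twist, copy, mem_ofPred_eq] at hp
  tauto

theorem IsDiffuseSubmeasure.preimage_fst_mem_alg (hd : IsDiffuseSubmeasure d) (C : Set (ℕ × ℕ)) :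
    (Prod.fst ⁻¹' C : Set ((ℕ × ℕ) × Bool)) ∈ alg d := by
  have : twist (Prod.fst ⁻¹' C) = ∅ := by ext p; simp [twist]
  change weight d _ < ⊤
  rw [this, hd.weight_empty]
  exact ENNReal.zero_lt_top

open Classical in
variable (d) in
/-- The trace of an ultrafilter on the algebra. -/
noncomputable def tr (u : Ultrafilter ((ℕ × ℕ) × Bool)) : ULift.{u} (alg d) → Bool :=
  fun A => decide (A.down.1 ∈ u)

variable (d) in
/-- The Stone space of the algebra, realised as the space of traces of ultrafilters. -/
def Spc : Type u := range (tr.{u} d)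

variable (d) in
theorem continuous_tr : Continuous (tr.{u} d) := by
  refine continuous_pi fun A => (continuous_bool_rng true).2 ?_
  have : (fun u => tr d u A) ⁻¹' {true} = {u | A.down.1 ∈ u} := by ext; simp [tr]
  rw [this]
  exact ⟨ultrafilter_isClosed_basic _, ultrafilter_isOpen_basic _⟩

instance : TopologicalSpace (Spc.{u} d) := inferInstanceAs (TopologicalSpace (range (tr.{u} d)))
instance : T2Space (Spc.{u} d) := inferInstanceAs (T2Space (range (tr.{u} d)))
instance : TotallyDisconnectedSpace (Spc.{u} d) :=
  inferInstanceAs (TotallyDisconnectedSpace (range (tr.{u} d)))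
instance : CompactSpace (Spc.{u} d) :=
  isCompact_iff_compactSpace.1 (isCompact_range (continuous_tr.{u} d))

variable (d) in
/-- The projection of the space of ultrafilters. -/
noncomputable def proj : Ultrafilter ((ℕ × ℕ) × Bool) → Spc.{u} d := rangeFactorization (tr.{u} d)

variable (d) in
theorem continuous_proj : Continuous (proj.{u} d) := (continuous_tr d).rangeFactorization

variable (d) in
theorem surjective_proj : Function.Surjective (proj.{u} d) := rangeFactorization_surjective

theorem mem_iff_of_proj_eq {u v : Ultrafilter ((ℕ × ℕ) × Bool)}
    (h : proj.{u} d u = proj.{u} d v) {A} (hA : A ∈ alg d) : A ∈ u ↔ A ∈ v := by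
  have := congrFun (congrArg Subtype.val h) ⟨A, hA⟩
  simpa [proj, tr] using this

theorem proj_eq_of_mem_iff {u v : Ultrafilter ((ℕ × ℕ) × Bool)}
    (h : ∀ A ∈ alg d, A ∈ u ↔ A ∈ v) : proj.{u} d u = proj.{u} d v := by
  refine Subtype.ext (funext fun A => ?_)
  simpa [proj, tr] using h A.down.1 A.down.2

variable (d) in
/-- The subset of the Stone space given by a set. -/
def bx (A : Set ((ℕ × ℕ) × Bool)) : Set (Spc.{u} d) := proj.{u} d '' {u | A ∈ u}

theorem proj_mem_bx {A} (hA : A ∈ alg d) {u} : proj.{u} d u ∈ bx.{u} d A ↔ A ∈ u :=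
  ⟨fun ⟨_, hv, h⟩ => (mem_iff_of_proj_eq h hA).1 hv, fun h => ⟨u, h, rfl⟩⟩

theorem bx_mono {A B : Set ((ℕ × ℕ) × Bool)} (h : A ⊆ B) : bx.{u} d A ⊆ bx.{u} d B :=
  image_mono fun _ hu => Filter.mem_of_superset hu h

theorem bx_union (A B : Set ((ℕ × ℕ) × Bool)) : bx.{u} d (A ∪ B) = bx.{u} d A ∪ bx.{u} d B := by
  rw [bx, bx, bx, ← image_union]
  congr 1
  ext u
  exact Ultrafilter.union_mem_iff

theorem bx_empty : bx.{u} d ∅ = ∅ := by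
  simp [bx]

theorem bx_univ : bx.{u} d univ = univ := by
  refine eq_univ_of_forall fun x => ?_
  obtain ⟨u, rfl⟩ := surjective_proj d x
  exact ⟨u, univ_mem, rfl⟩

theorem IsDiffuseSubmeasure.bx_inter (hd : IsDiffuseSubmeasure d)
    {A B} (hA : A ∈ alg d) (hB : B ∈ alg d) :
    bx.{u} d (A ∩ B) = bx.{u} d A ∩ bx.{u} d B := by
  ext x
  obtain ⟨u, rfl⟩ := surjective_proj d x
  rw [mem_inter_iff, proj_mem_bx hA, proj_mem_bx hB, proj_mem_bx (hd.inter_mem_alg hA hB)]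
  exact inter_mem_iff

theorem IsDiffuseSubmeasure.bx_compl (hd : IsDiffuseSubmeasure d) {A} (hA : A ∈ alg d) :
    bx.{u} d Aᶜ = (bx.{u} d A)ᶜ := by
  ext x
  obtain ⟨u, rfl⟩ := surjective_proj d x
  rw [mem_compl_iff, proj_mem_bx hA, proj_mem_bx (hd.compl_mem_alg hA)]
  exact Ultrafilter.compl_mem_iff_notMem

theorem IsDiffuseSubmeasure.disjoint_bx (hd : IsDiffuseSubmeasure d)
    {A B} (hA : A ∈ alg d) (hB : B ∈ alg d)
    (h : Disjoint A B) : Disjoint (bx.{u} d A) (bx.{u} d B) := by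
  rw [disjoint_iff_inter_eq_empty, ← hd.bx_inter hA hB, h.inter_eq, bx_empty]

theorem IsDiffuseSubmeasure.isClopen_bx (hd : IsDiffuseSubmeasure d)
    {A} (hA : A ∈ alg d) : IsClopen (bx.{u} d A) := by
  have : ∀ A, IsClosed (bx.{u} d A) := fun A =>
    ((ultrafilter_isClosed_basic A).isCompact.image (continuous_proj d)).isClosed
  refine ⟨this A, ?_⟩
  rw [← isClosed_compl_iff, ← hd.bx_compl hA]
  exact this _

theorem IsDiffuseSubmeasure.exists_bx_subset (hd : IsDiffuseSubmeasure d)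
    {W : Set (Spc.{u} d)} (hW : IsOpen W) {x : Spc.{u} d}
    (hx : x ∈ W) : ∃ A ∈ alg d, x ∈ bx.{u} d A ∧ bx.{u} d A ⊆ W := by
  have hempty : (∅ : Set ((ℕ × ℕ) × Bool)) ∈ alg d := hd.preimage_fst_mem_alg ∅
  suffices h : ∃ A ∈ alg d, x ∈ bx.{u} d A ∧ Disjoint (bx.{u} d A) Wᶜ by
    simpa only [disjoint_compl_right_iff_subset] using h
  refine hW.isClosed_compl.isCompact.induction_on
    (p := fun s => ∃ A ∈ alg d, x ∈ bx.{u} d A ∧ Disjoint (bx.{u} d A) s) ?_ ?_ ?_ ?_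
  · exact ⟨univ, by simpa using hd.compl_mem_alg hempty, by simp [bx_univ], disjoint_empty _⟩
  · rintro s t hst ⟨A, hA, h1, h2⟩
    exact ⟨A, hA, h1, h2.mono_right hst⟩
  · rintro s t ⟨A, hA, h1, h2⟩ ⟨B, hB, h3, h4⟩
    refine ⟨A ∩ B, hd.inter_mem_alg hA hB, ?_, ?_⟩
    · rw [hd.bx_inter hA hB]
      exact ⟨h1, h3⟩
    · rw [disjoint_union_right]
      exact ⟨h2.mono_left (bx_mono inter_subset_left), h4.mono_left (bx_mono inter_subset_right)⟩
  · intro y hy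
    obtain ⟨u, rfl⟩ := surjective_proj d x
    obtain ⟨v, rfl⟩ := surjective_proj d y
    have hne : ∃ A ∈ alg d, A ∈ u ∧ A ∉ v := by
      by_contra! hcon
      refine hy ?_
      rwa [← proj_eq_of_mem_iff (u := u) (v := v)]
      refine fun A hA => ⟨fun h => ?_, fun h => ?_⟩
      · exact hcon A hA h
      · by_contra h'
        exact Ultrafilter.compl_mem_iff_notMem.1
          (hcon _ (hd.compl_mem_alg hA) (Ultrafilter.compl_mem_iff_notMem.2 h')) h
    obtain ⟨A, hA, hu, hv⟩ := hne
    refine ⟨(bx.{u} d A)ᶜ, mem_nhdsWithin_of_mem_nhds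
      ((hd.isClopen_bx hA).compl.isOpen.mem_nhds fun h => hv ((proj_mem_bx hA).1 h)),
      A, hA, (proj_mem_bx hA).2 hu, disjoint_compl_right⟩

theorem IsDiffuseSubmeasure.exists_bx_eq (hd : IsDiffuseSubmeasure d)
    {W : Set (Spc.{u} d)} (hW : IsClopen W) :
    ∃ A ∈ alg d, bx.{u} d A = W := by
  suffices h : ∃ A ∈ alg d, W ⊆ bx.{u} d A ∧ bx.{u} d A ⊆ W by
    obtain ⟨A, hA, h1, h2⟩ := h
    exact ⟨A, hA, h2.antisymm h1⟩
  refine hW.isClosed.isCompact.induction_on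
    (p := fun s => ∃ A ∈ alg d, s ⊆ bx.{u} d A ∧ bx.{u} d A ⊆ W) ?_ ?_ ?_ ?_
  · exact ⟨∅, hd.preimage_fst_mem_alg ∅, empty_subset _, by simp [bx_empty]⟩
  · rintro s t hst ⟨A, hA, h1, h2⟩
    exact ⟨A, hA, hst.trans h1, h2⟩
  · rintro s t ⟨A, hA, h1, h2⟩ ⟨B, hB, h3, h4⟩
    refine ⟨A ∪ B, hd.union_mem_alg hA hB, ?_, ?_⟩
    · rw [bx_union]
      exact union_subset_union h1 h3
    · rw [bx_union]
      exact union_subset h2 h4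
  · intro x hx
    obtain ⟨A, hA, h1, h2⟩ := hd.exists_bx_subset hW.isOpen hx
    exact ⟨bx.{u} d A, mem_nhdsWithin_of_mem_nhds ((hd.isClopen_bx hA).isOpen.mem_nhds h1),
      A, hA, Subset.rfl, h2⟩

end Space

section Charges

variable {d : Set ℕ → ℝ≥0∞}

theorem copy_mono {C D : Set (ℕ × ℕ)} (h : C ⊆ D) (b : Bool) : copy C b ⊆ copy D b :=
  fun _ hq => ⟨h hq.1, hq.2⟩

theorem IsDiffuseSubmeasure.biUnion_le (hd : IsDiffuseSubmeasure d) {ι : Type*} (s : Finset ι)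
    (A : ι → Set ℕ) : d (⋃ i ∈ s, A i) ≤ ∑ i ∈ s, d (A i) := by
  classical
  induction s using Finset.induction_on with
  | empty => simp [hd.empty]
  | insert a s ha ih =>
    rw [Finset.sum_insert ha, Finset.set_biUnion_insert]
    exact (hd.union_le _ _).trans (by gcongr)

/-- A set of finite weight may be shrunk to one of small weight without losing a given point. -/
theorem IsDiffuseSubmeasure.exists_shrink_singleton (hd : IsDiffuseSubmeasure d)
    {C : Set (ℕ × ℕ)} (hC : weight d C < ⊤) {b : Bool} {x : Spc.{u} d}
    (hx : x ∈ bx.{u} d (copy C b)) {e : ℝ≥0∞} (he : e ≠ 0) :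
    ∃ C' ⊆ C, weight d C' ≤ e ∧ x ∈ bx.{u} d (copy C' b) := by
  obtain ⟨u, hu, rfl⟩ := hx
  have he2 : e / 2 ≠ 0 := by simpa using he
  obtain ⟨N, hN⟩ := ((ENNReal.tendsto_sum_nat_add _ hC.ne).eventually_le_const
    (pos_iff_ne_zero.2 he2)).exists
  obtain ⟨M, hM, hMr⟩ := hd.exists_modulus (e / 2 / N) (by simp [he])
  have hr : ∃ r ∈ (Finset.range M : Set ℕ), {q : (ℕ × ℕ) × Bool | q.1.2 % M = r} ∈ u := by
    rw [← Ultrafilter.finite_biUnion_mem_iff (Finset.finite_toSet _)]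
    refine Filter.mem_of_superset univ_mem fun q _ => ?_
    exact mem_biUnion (x := q.1.2 % M) (by simpa using Nat.mod_lt _ hM) rfl
  obtain ⟨r, -, hr⟩ := hr
  let C' : Set (ℕ × ℕ) := {p | p ∈ C ∧ (N ≤ p.1 ∨ p.2 % M = r)}
  refine ⟨C', fun p hp => hp.1, ?_, ?_⟩
  · have hsplit : weight d C' = ∑ n ∈ Finset.range N, d {i | (n, i) ∈ C'} +
        ∑' n, d {i | (n + N, i) ∈ C'} :=
      (Summable.sum_add_tsum_nat_add' (f := fun n => d {i | (n, i) ∈ C'})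
        ENNReal.summable).symm
    rw [hsplit, ← ENNReal.add_halves e]
    refine add_le_add ?_ (le_trans ?_ hN)
    · refine (Finset.sum_le_card_nsmul _ _ (e / 2 / N) fun n hn => ?_).trans ?_
      · refine (hd.mono fun i hi => ?_).trans (hMr r)
        exact hi.2.resolve_left (by simpa using hn)
      · rw [Finset.card_range, nsmul_eq_mul]
        exact ENNReal.mul_div_le
    · exact ENNReal.tsum_le_tsum fun n => hd.mono fun i hi => hi.1
  · refine ⟨u, Filter.mem_of_superset (inter_mem hu hr) ?_, rfl⟩
    rintro q ⟨h1, h2⟩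
    exact ⟨⟨h1.1, Or.inr h2⟩, h1.2⟩

theorem IsDiffuseSubmeasure.exists_shrink (hd : IsDiffuseSubmeasure d)
    {C : Set (ℕ × ℕ)} (hC : weight d C < ⊤) {b : Bool} (T : Finset (Spc.{u} d))
    (hT : (T : Set (Spc.{u} d)) ⊆ bx.{u} d (copy C b)) {e : ℝ≥0∞} (he : e ≠ 0) :
    ∃ C' ⊆ C, weight d C' ≤ e ∧ (T : Set (Spc.{u} d)) ⊆ bx.{u} d (copy C' b) := by
  classical
  induction T using Finset.induction_on generalizing e with
  | empty => exact ⟨∅, empty_subset _, by simp [hd.weight_empty], by simp⟩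
  | insert x T _ ih =>
    have he2 : e / 2 ≠ 0 := by simpa using he
    rw [Finset.coe_insert, insert_subset_iff] at hT
    obtain ⟨C1, h1, hw1, hx⟩ := hd.exists_shrink_singleton hC hT.1 he2
    obtain ⟨C2, h2, hw2, hx2⟩ := ih hT.2 he2
    refine ⟨C1 ∪ C2, union_subset h1 h2, (hd.weight_union_le _ _).trans ?_, ?_⟩
    · rw [← ENNReal.add_halves e]
      exact add_le_add hw1 hw2
    · rw [Finset.coe_insert, insert_subset_iff]
      exact ⟨bx_mono (copy_mono subset_union_left b) hx,
        hx2.trans (bx_mono (copy_mono subset_union_right b))⟩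

variable {θ : ℕ → Spc.{u} d →₀ ℝ}

theorem IsDiffuseSubmeasure.not_forall_chg_copy_of_weight_iUnion (hd : IsDiffuseSubmeasure d)
    (h : WNull θ) {C : ℕ → Set (ℕ × ℕ)} (hdisj : ∀ k l, k ≠ l → Disjoint (C k) (C l))
    (hC : weight d (⋃ k, C k) < ⊤) (b : Bool) {δ : ℝ} (hδ : 0 < δ) :
    ¬ ∀ k, δ ≤ |chg (θ k) (bx.{u} d (copy (C k) b))| := by
  obtain ⟨B, hB⟩ := h.exists_bound
  have hmem : ∀ S : Set ℕ, copy (⋃ k ∈ S, C k) b ∈ alg d := fun S =>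
    hd.copy_mem_alg ((hd.weight_mono (iUnion₂_subset_iUnion _ _)).trans_lt hC) b
  have := h.not_forall_le_abs_chg hB (fun S => bx.{u} d (copy (⋃ k ∈ S, C k) b))
    (fun S => hd.isClopen_bx (hmem S)) (fun S T => by
      rw [← bx_union, biUnion_union]
      congr 1
      ext q
      simp only [copy, mem_union, mem_ofPred_eq]
      tauto) (fun S T hST => by
      refine hd.disjoint_bx (hmem S) (hmem T) (disjoint_left.2 fun q hS hT => ?_)
      obtain ⟨k, hk, hkq⟩ := mem_iUnion₂.1 hS.1
      obtain ⟨l, hl, hlq⟩ := mem_iUnion₂.1 hT.1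
      exact disjoint_left.1 (hdisj k l (fun h => disjoint_left.1 hST hk (h ▸ hl))) hkq hlq) hδ
  simpa using this

theorem IsDiffuseSubmeasure.not_forall_chg_copy (hd : IsDiffuseSubmeasure d)
    (h : WNull θ) {C : ℕ → Set (ℕ × ℕ)} (hdisj : ∀ k l, k ≠ l → Disjoint (C k) (C l))
    (hC : ∀ k, weight d (C k) < ⊤) (b : Bool) {δ : ℝ} (hδ : 0 < δ) :
    ¬ ∀ k, δ ≤ |chg (θ k) (bx.{u} d (copy (C k) b))| := by
  intro hcon
  let E : ℕ → Set (ℕ × ℕ) := fun N => {p | p.1 < N}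
  have hE : ∀ N, weight d (E N) < ⊤ := by
    intro N
    unfold weight
    rw [tsum_eq_sum (s := Finset.range N) fun n hn => by
      convert hd.empty
      ext i
      simpa [E] using hn]
    exact ENNReal.sum_lt_top.2 fun n _ => (hd.mono (subset_univ _)).trans_lt hd.univ_ne_top.lt_top
  have hsmall : ∀ N, ∀ᶠ k in atTop, |chg (θ k) (bx.{u} d (copy (C k ∩ E N) b))| < δ / 2 := by
    intro N
    by_contra hN
    obtain ⟨n, hn, hnδ⟩ := extraction_of_frequently_atTop (not_eventually.1 hN)
    refine hd.not_forall_chg_copy_of_weight_iUnion (h.comp hn.tendsto_atTop)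
      (C := fun k => C (n k) ∩ E N)
      (fun k l hkl => (hdisj _ _ (hn.injective.ne hkl)).mono inter_subset_left inter_subset_left)
      ((hd.weight_mono (iUnion_subset fun k => inter_subset_right)).trans_lt (hE N)) b
      (half_pos hδ) fun k => not_lt.1 (hnδ k)
  obtain ⟨g, hg, hgδ⟩ := extraction_forall_of_eventually hsmall
  have hfar : ∀ N, weight d (C (g N) \ E N) < ⊤ := fun N =>
    (hd.weight_mono sdiff_subset).trans_lt (hC _)
  classical
  choose D hDC hDw hDT using fun N => hd.exists_shrink (hfar N) (b := b)
    ((θ (g N)).support.filter (· ∈ bx.{u} d (copy (C (g N) \ E N) b)))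
    (fun x hx => (Finset.mem_filter.1 hx).2) (e := 2⁻¹ ^ N)
    (by simp)
  have hDD : ∀ k l, k ≠ l → Disjoint (D k) (D l) := fun k l hkl =>
    (hdisj _ _ (hg.injective.ne hkl)).mono ((hDC k).trans sdiff_subset)
      ((hDC l).trans sdiff_subset)
  have hw : weight d (⋃ N, D N) < ⊤ := by
    calc weight d (⋃ N, D N) ≤ ∑' n, ∑' N, d {i | (n, i) ∈ D N} := by
          refine ENNReal.tsum_le_tsum fun n => ?_
          refine le_trans (hd.mono fun i hi => ?_) ((hd.biUnion_le (Finset.range (n + 1))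
            (fun N => {i | (n, i) ∈ D N})).trans (ENNReal.sum_le_tsum _))
          obtain ⟨N, hN⟩ := mem_iUnion.1 hi
          have := (hDC N hN).2
          refine mem_biUnion (x := N) ?_ hN
          simp [E] at this ⊢
          omega
      _ = ∑' N, weight d (D N) := ENNReal.tsum_comm
      _ ≤ ∑' N, 2⁻¹ ^ N := ENNReal.tsum_le_tsum hDw
      _ < ⊤ := by
          rw [ENNReal.tsum_geometric]
          simp
  refine hd.not_forall_chg_copy_of_weight_iUnion (h.comp hg.tendsto_atTop) hDD hw b
    (half_pos hδ) fun N => ?_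
  have h1 : chg (θ (g N)) (bx.{u} d (copy (D N) b)) =
      chg (θ (g N)) (bx.{u} d (copy (C (g N) \ E N) b)) := chg_congr fun x hx =>
    ⟨fun hxD => bx_mono (copy_mono (hDC N) b) hxD, fun hxC =>
      hDT N (Finset.mem_coe.2 (Finset.mem_filter.2 ⟨hx, hxC⟩))⟩
  have hmem1 := hd.copy_mem_alg (hfar N) b
  have hmem2 := hd.copy_mem_alg
    ((hd.weight_mono (inter_subset_left (s := C (g N)) (t := E N))).trans_lt (hC _)) b
  have h2 : chg (θ (g N)) (bx.{u} d (copy (C (g N)) b)) =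
      chg (θ (g N)) (bx.{u} d (copy (C (g N) \ E N) b)) +
        chg (θ (g N)) (bx.{u} d (copy (C (g N) ∩ E N) b)) := by
    rw [← chg_union _ (hd.disjoint_bx hmem1 hmem2 (disjoint_left.2 fun q hq hq' =>
      hq.1.2 hq'.1.2)), ← bx_union]
    congr 2
    ext q
    simp only [copy, mem_union, mem_ofPred_eq, Set.mem_sdiff, mem_inter_iff]
    tauto
  have h3 := hcon (g N)
  rw [h2] at h3
  rw [h1]
  linarith [h3.trans (abs_add_le _ _), hgδ N]

variable (d) in
/-- The points of the Stone space lying in one copy of a set of finite weight. -/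
def lightPoints (b : Bool) : Set (Spc.{u} d) :=
  {x | ∃ C, weight d C < ⊤ ∧ x ∈ bx.{u} d (copy C b)}

theorem IsDiffuseSubmeasure.exists_weight_lightPoints (hd : IsDiffuseSubmeasure d)
    (T : Finset (Spc.{u} d)) (b : Bool) :
    ∃ C, weight d C < ⊤ ∧ ∀ x ∈ T, x ∈ lightPoints d b → x ∈ bx.{u} d (copy C b) := by
  classical
  induction T using Finset.induction_on with
  | empty => exact ⟨∅, by simp [hd.weight_empty], by simp⟩
  | insert x T _ ih =>
    obtain ⟨C, hC, hT⟩ := ih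
    by_cases hx : x ∈ lightPoints d b
    · obtain ⟨C', hC', hxC'⟩ := hx
      refine ⟨C' ∪ C, (hd.weight_union_le _ _).trans_lt (ENNReal.add_lt_top.2 ⟨hC', hC⟩), ?_⟩
      intro y hy hyb
      rcases Finset.mem_insert.1 hy with rfl | hy
      · exact bx_mono (copy_mono subset_union_left b) hxC'
      · exact bx_mono (copy_mono subset_union_right b) (hT y hy hyb)
    · refine ⟨C, hC, fun y hy hyb => ?_⟩
      rcases Finset.mem_insert.1 hy with rfl | hy
      · exact absurd hyb hx
      · exact hT y hy hyb

theorem IsDiffuseSubmeasure.not_forall_chg_lightPoints (hd : IsDiffuseSubmeasure d)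
    (h : WNull θ) {A : ℕ → Set ((ℕ × ℕ) × Bool)} (hA : ∀ k, A k ∈ alg d)
    (hdisj : ∀ k l, k ≠ l → Disjoint (A k) (A l)) (b : Bool) {δ : ℝ} (hδ : 0 < δ) :
    ¬ ∀ k, δ ≤ |chg (θ k) (bx.{u} d (A k) ∩ lightPoints d b)| := by
  intro hcon
  choose C hC hCT using fun k => hd.exists_weight_lightPoints (θ k).support b
  have hw : ∀ k, weight d {p ∈ C k | (p, b) ∈ A k} < ⊤ := fun k =>
    (hd.weight_mono fun p hp => hp.1).trans_lt (hC k)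
  refine hd.not_forall_chg_copy h (C := fun k => {p ∈ C k | (p, b) ∈ A k})
    (fun k l hkl => disjoint_left.2 fun p hp hp' => disjoint_left.1 (hdisj k l hkl) hp.2 hp'.2)
    hw b hδ fun k => ?_
  convert hcon k using 2
  refine chg_congr fun x hx => ?_
  have hcopy : copy {p ∈ C k | (p, b) ∈ A k} b = copy (C k) b ∩ A k := by
    ext ⟨p, b'⟩
    simp only [copy, mem_inter_iff, mem_ofPred_eq]
    constructor
    · rintro ⟨⟨h1, h2⟩, rfl⟩
      exact ⟨⟨h1, rfl⟩, h2⟩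
    · rintro ⟨⟨h1, rfl⟩, h2⟩
      exact ⟨⟨h1, h2⟩, rfl⟩
  rw [hcopy, hd.bx_inter (hd.copy_mem_alg (hC k) b) (hA k)]
  exact ⟨fun h' => ⟨h'.2, C k, hC k, h'.1⟩, fun h' => ⟨hCT k x hx h'.2, h'.1⟩⟩

theorem IsDiffuseSubmeasure.not_forall_chg_heavyPoints (hd : IsDiffuseSubmeasure d)
    (h : WNull θ) {A : ℕ → Set ((ℕ × ℕ) × Bool)} (hA : ∀ k, A k ∈ alg d)
    (hdisj : ∀ k l, k ≠ l → Disjoint (A k) (A l)) {δ : ℝ} (hδ : 0 < δ) :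
    ¬ ∀ k, δ ≤ |chg (θ k) ((bx.{u} d (A k) \ lightPoints d false) \ lightPoints d true)| := by
  intro hcon
  obtain ⟨B, hB⟩ := h.exists_bound
  choose Q hQ hQT using fun k b => hd.exists_weight_lightPoints (θ k).support b
  let C : ℕ → Set (ℕ × ℕ) := fun k => (Q k false ∪ Q k true) ∪ twist (A k)
  have hC : ∀ k, weight d (C k) < ⊤ := fun k =>
    (hd.weight_union_le _ _).trans_lt (ENNReal.add_lt_top.2 ⟨(hd.weight_union_le _ _).trans_lt
      (ENNReal.add_lt_top.2 ⟨hQ k _, hQ k _⟩), hA k⟩)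
  let D : ℕ → Set (ℕ × ℕ) := fun k => {p | (p, false) ∈ A k} \ C k
  have hD : ∀ k l, k ≠ l → Disjoint (D k) (D l) := fun k l hkl =>
    disjoint_left.2 fun p hp hp' => disjoint_left.1 (hdisj k l hkl) hp.1 hp'.1
  have hDA : ∀ k, Prod.fst ⁻¹' D k ⊆ A k := by
    rintro k ⟨p, b⟩ ⟨h1, h2⟩
    have h3 : p ∉ twist (A k) := fun h' => h2 (Or.inr h')
    simp only [twist, mem_ofPred_eq, not_not] at h3 h1
    cases b
    · exact h1
    · exact h3.1 h1
  have hmem : ∀ C : Set (ℕ × ℕ), (Prod.fst ⁻¹' C : Set ((ℕ × ℕ) × Bool)) ∈ alg d :=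
    hd.preimage_fst_mem_alg
  have key := h.not_forall_le_abs_chg hB (fun S => bx.{u} d (Prod.fst ⁻¹' ⋃ k ∈ S, D k))
    (fun S => hd.isClopen_bx (hmem _)) (fun S T => by
      rw [← bx_union, biUnion_union, preimage_union]) (fun S T hST => by
      refine hd.disjoint_bx (hmem _) (hmem _) (Disjoint.preimage _ (disjoint_left.2
        fun q hS hT => ?_))
      obtain ⟨k, hk, hkq⟩ := mem_iUnion₂.1 hS
      obtain ⟨l, hl, hlq⟩ := mem_iUnion₂.1 hT
      exact disjoint_left.1 (hD k l (fun h => disjoint_left.1 hST hk (h ▸ hl))) hkq hlq) hδ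
  refine key fun k => ?_
  convert hcon k using 2
  refine chg_congr fun x hx => ?_
  rw [biUnion_singleton]
  obtain ⟨u, rfl⟩ := surjective_proj d x
  rw [proj_mem_bx (hmem _)]
  constructor
  · intro hu
    have hlight : ∀ b, proj d u ∉ lightPoints d b := by
      intro b hb
      have h1 := (proj_mem_bx (hd.copy_mem_alg (hQ k b) b)).1 (hQT k b _ hx hb)
      obtain ⟨q, hq1, hq2⟩ := u.nonempty_of_mem (inter_mem hu h1)
      refine hq1.2 (Or.inl ?_)
      cases b
      · exact Or.inl hq2.1
      · exact Or.inr hq2.1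
    exact ⟨⟨(proj_mem_bx (hA k)).2 (Filter.mem_of_superset hu (hDA k)), hlight false⟩, hlight true⟩
  · rintro ⟨⟨h1, h2⟩, h3⟩
    rw [proj_mem_bx (hA k)] at h1
    have hcopy : ∀ b, copy (C k) b ∉ u := by
      intro b hb
      cases b
      · exact h2 ⟨C k, hC k, u, hb, rfl⟩
      · exact h3 ⟨C k, hC k, u, hb, rfl⟩
    refine Filter.mem_of_superset (inter_mem h1 (inter_mem
      (Ultrafilter.compl_mem_iff_notMem.2 (hcopy false))
      (Ultrafilter.compl_mem_iff_notMem.2 (hcopy true)))) ?_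
    rintro ⟨p, b⟩ ⟨hp, hf, ht⟩
    have hpC : p ∉ C k := by
      intro hpC
      cases b
      · exact hf ⟨hpC, rfl⟩
      · exact ht ⟨hpC, rfl⟩
    refine ⟨?_, hpC⟩
    have h3 : p ∉ twist (A k) := fun h' => hpC (Or.inr h')
    simp only [twist, mem_ofPred_eq, not_not] at h3
    cases b
    · exact hp
    · exact h3.2 hp

theorem IsDiffuseSubmeasure.noDisjointCharges (hd : IsDiffuseSubmeasure d) :
    NoDisjointCharges (Spc.{u} d) := by
  intro θ h W hW hWd δ hδ hcon
  choose A hA hAW using fun k => hd.exists_bx_eq (hW k)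
  have hdisj : ∀ k l, k ≠ l → Disjoint (A k) (A l) := by
    have : ∀ k l, k < l → Disjoint (A k) (A l) := by
      intro k l hkl
      rw [disjoint_left]
      intro q hq hq'
      refine disjoint_left.1 (hWd k l hkl) (?_ : proj d (pure q) ∈ W k) ?_
      · rw [← hAW, proj_mem_bx (hA k)]
        exact hq
      · rw [← hAW, proj_mem_bx (hA l)]
        exact hq'
    intro k l hkl
    rcases lt_or_gt_of_ne hkl with h | h
    · exact this k l h
    · exact (this l k h).symm
  have hsub : ∀ P : ℕ → Set (Spc.{u} d),
      (∀ n : ℕ → ℕ, StrictMono n → ¬ ∀ k, δ / 3 ≤ |chg (θ (n k)) (P (n k))|) →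
      ∀ᶠ k in atTop, |chg (θ k) (P k)| < δ / 3 := by
    intro P hP
    by_contra hN
    obtain ⟨n, hn, hnδ⟩ := extraction_of_frequently_atTop (not_eventually.1 hN)
    exact hP n hn fun k => not_lt.1 (hnδ k)
  have hδ3 : 0 < δ / 3 := by positivity
  have e1 := fun b => hsub (fun k => bx.{u} d (A k) ∩ lightPoints d b) fun n hn =>
    hd.not_forall_chg_lightPoints (h.comp hn.tendsto_atTop) (A := fun k => A (n k))
      (fun k => hA _) (fun k l hkl => hdisj _ _ (hn.injective.ne hkl)) b hδ3
  have e2 := hsub (fun k => (bx.{u} d (A k) \ lightPoints d false) \ lightPoints d true)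
    fun n hn => hd.not_forall_chg_heavyPoints (h.comp hn.tendsto_atTop) (A := fun k => A (n k))
      (fun k => hA _) (fun k l hkl => hdisj _ _ (hn.injective.ne hkl)) hδ3
  obtain ⟨k, h1, h2, h3⟩ := ((e1 false).and ((e1 true).and e2)).exists
  have hlt : ∀ x, x ∈ lightPoints.{u} d false → x ∈ lightPoints.{u} d true → False := by
    rintro x ⟨C, hC, hx⟩ ⟨C', hC', hx'⟩
    refine disjoint_left.1 (hd.disjoint_bx (hd.copy_mem_alg hC false) (hd.copy_mem_alg hC' true)
      (disjoint_left.2 fun q hq hq' => ?_)) hx hx'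
    exact Bool.false_ne_true (hq.2.symm.trans hq'.2)
  have h4 := chg_sdiff_add_inter (θ k) (bx.{u} d (A k)) (lightPoints d false)
  have h5 := chg_sdiff_add_inter (θ k) (bx.{u} d (A k) \ lightPoints d false) (lightPoints d true)
  have h6 : (bx.{u} d (A k) \ lightPoints d false) ∩ lightPoints d true =
      bx.{u} d (A k) ∩ lightPoints d true := by
    ext x
    exact ⟨fun hx => ⟨hx.1.1, hx.2⟩, fun hx => ⟨⟨hx.1, fun h' => hlt x h' hx.2⟩, hx.2⟩⟩
  rw [h6] at h5
  have h7 := hcon k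
  rw [← hAW, ← h4, ← h5] at h7
  have h8 := h7.trans (abs_add_three _ _ _)
  linarith

theorem IsDiffuseSubmeasure.finSchur (hd : IsDiffuseSubmeasure d) : FinSchur (Spc.{u} d) :=
  finSchur_of_noDisjointCharges hd.noDisjointCharges

end Charges

section DiffuseMeasure

/-- There is a regular probability measure on the space of ultrafilters on `ℕ` giving small measure
to residue classes. -/
theorem exists_diffuse_measure [MeasurableSpace (Ultrafilter ℕ)] [BorelSpace (Ultrafilter ℕ)] :
    ∃ m : Measure (Ultrafilter ℕ), IsProbabilityMeasure m ∧ m.Regular ∧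
      ∀ M : ℕ, 0 < M → ∀ r, m.real {u | {i | i % M = r} ∈ u} ≤ 2 / M := by
  classical
  let α : ℕ → Measure (Ultrafilter ℕ) := fun N =>
    ((N + 1 : ℕ) : ℝ≥0∞)⁻¹ • ∑ i ∈ Finset.range (N + 1), Measure.dirac (pure i)
  have hα : ∀ N, IsProbabilityMeasure (α N) := by
    intro N
    refine ⟨?_⟩
    simp only [α, Measure.smul_apply, Measure.finsetSum_apply, measure_univ, Finset.sum_const,
      Finset.card_range, smul_eq_mul, nsmul_eq_mul, mul_one]
    exact ENNReal.inv_mul_cancel (by simp) (by simp)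
  let P : ℕ → ProbabilityMeasure (Ultrafilter ℕ) := fun N => ⟨α N, hα N⟩
  let F : Ultrafilter (ProbabilityMeasure (Ultrafilter ℕ)) := (hyperfilter ℕ).map P
  have hlim : Tendsto P (hyperfilter ℕ) (𝓝 F.lim) := F.le_nhds_lim
  obtain ⟨m, hm, hmfin, hmint⟩ :=
    Measure.exists_regular_eq_of_compactSpace (F.lim : Measure (Ultrafilter ℕ))
  have := hm
  have := hmfin
  refine ⟨m, ⟨?_⟩, hm, fun M hM r => ?_⟩
  · have h1 := hmint (BoundedContinuousFunction.const _ (1 : ℝ))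
    simp only [BoundedContinuousFunction.const_apply, integral_const, smul_eq_mul, mul_one,
      probReal_univ] at h1
    rw [← ENNReal.toReal_eq_one_iff]
    simpa [measureReal_def] using h1.symm
  set R : Set (Ultrafilter ℕ) := {u | {i | i % M = r} ∈ u} with hR
  have hRc : IsClopen R := ⟨ultrafilter_isClosed_basic _, ultrafilter_isOpen_basic _⟩
  let f : BoundedContinuousFunction (Ultrafilter ℕ) ℝ :=
    BoundedContinuousFunction.mkOfCompact ⟨R.indicator 1, hRc.continuous_indicator continuous_one⟩
  have hf : ∀ μ : Measure (Ultrafilter ℕ), ∫ u, f u ∂μ = μ.real R := fun μ =>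
    integral_indicator_one hRc.isOpen.measurableSet
  have hlimf := (ProbabilityMeasure.tendsto_iff_forall_integral_tendsto.1 hlim) f
  rw [← hf m, ← hmint f]
  refine le_of_tendsto hlimf ?_
  have hev : ∀ᶠ N in (hyperfilter ℕ : Filter ℕ), M ≤ N + 1 :=
    Nat.hyperfilter_le_atTop ((eventually_ge_atTop M).mono fun N hN => by omega)
  filter_upwards [hev] with N hN
  have hαR : (α N).real R = ((N + 1 : ℕ) : ℝ)⁻¹ *
      (((Finset.range (N + 1)).filter (fun i => i % M = r)).card : ℝ) := by
    have hdirac : ∀ i : ℕ, (Measure.dirac (pure i : Ultrafilter ℕ)) R =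
        if i % M = r then 1 else 0 := by
      intro i
      rw [Measure.dirac_apply' _ hRc.isOpen.measurableSet]
      simp [indicator, hR]
    simp only [measureReal_def, α, Measure.smul_apply, Measure.finsetSum_apply, hdirac, smul_eq_mul,
      Finset.sum_boole, ENNReal.toReal_mul, ENNReal.toReal_inv, ENNReal.toReal_natCast]
  have hcard : ((Finset.range (N + 1)).filter (fun i => i % M = r)).card ≤ (N + 1) / M + 1 := by
    rw [← Finset.card_range ((N + 1) / M + 1)]
    refine Finset.card_le_card_of_injOn (· / M) (fun i hi => ?_) fun i hi j hj hij => ?_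
    · simp only [Finset.coe_filter, Finset.mem_range, mem_ofPred_eq, Finset.coe_range, mem_Iio]
        at hi ⊢
      exact Nat.lt_succ_of_le (Nat.div_le_div_right hi.1.le)
    · simp only [Finset.coe_filter, Finset.mem_range, mem_ofPred_eq] at hi hj hij
      rw [← Nat.div_add_mod i M, ← Nat.div_add_mod j M, hij, hi.2, hj.2]
  have hcard' : (((Finset.range (N + 1)).filter (fun i => i % M = r)).card : ℝ) * M
      ≤ 2 * (N + 1 : ℕ) := by
    have h2 := Nat.mul_le_mul_right M hcard
    have h3 := Nat.div_mul_le_self (N + 1) M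
    exact_mod_cast h2.trans (by rw [add_mul]; omega)
  change ∫ u, f u ∂(α N) ≤ _
  rw [hf, hαR]
  have hM' : (0 : ℝ) < M := by exact_mod_cast hM
  have hN' : (0 : ℝ) < (N + 1 : ℕ) := by positivity
  rw [inv_mul_eq_div, div_le_div_iff₀ hN' hM']
  exact hcard'

/-- A measure on ultrafilters that is small on residue classes induces a diffuse submeasure. -/
theorem isDiffuseSubmeasure_of_measure [MeasurableSpace (Ultrafilter ℕ)]
    {m : Measure (Ultrafilter ℕ)} [IsProbabilityMeasure m]
    (h : ∀ M : ℕ, 0 < M → ∀ r, m.real {u | {i | i % M = r} ∈ u} ≤ 2 / M) :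
    IsDiffuseSubmeasure fun D => m {u | D ∈ u} where
  empty := by simp
  mono hAB := measure_mono fun _ hu => mem_of_superset hu hAB
  union_le A B := by
    refine (measure_mono fun u hu => ?_).trans (measure_union_le _ _)
    exact Ultrafilter.union_mem_iff.1 hu
  univ_ne_top := measure_ne_top _ _
  exists_modulus e he := by
    by_cases hee : e = ⊤
    · exact ⟨1, one_pos, fun r => hee ▸ le_top⟩
    have he' : 0 < e.toReal := ENNReal.toReal_pos he hee
    obtain ⟨M, hM⟩ := exists_nat_gt (2 / e.toReal)
    have hM0 : (0 : ℝ) < M := lt_of_le_of_lt (by positivity) hM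
    refine ⟨M, by exact_mod_cast hM0, fun r => ?_⟩
    rw [← ENNReal.ofReal_toReal hee, ← ENNReal.ofReal_toReal (measure_ne_top m _)]
    refine ENNReal.ofReal_le_ofReal ((h M (by exact_mod_cast hM0) r).trans ?_)
    rw [div_le_iff₀ hM0]
    rw [div_lt_iff₀ he'] at hM
    linarith

end DiffuseMeasure

/-- A signed measure takes values bounded by its total variation norm. -/
theorem abs_apply_le_tvNorm {L : Type*} [MeasurableSpace L] (σ : SignedMeasure L)
    {V : Set L} (hV : MeasurableSet V) : |σ V| ≤ tvNorm σ := by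
  have h := σ.apply_eq_posPart_real_sub_negPart_real hV
  have h1 := measureReal_mono (μ := σ.toJordanDecomposition.posPart) (subset_univ V)
  have h2 := measureReal_mono (μ := σ.toJordanDecomposition.negPart) (subset_univ V)
  rw [tvNorm, ← measureReal_def, SignedMeasure.totalVariation, measureReal_add_apply, h, abs_le]
  constructor <;> linarith [measureReal_nonneg (μ := σ.toJordanDecomposition.posPart) (s := V),
    measureReal_nonneg (μ := σ.toJordanDecomposition.negPart) (s := V)]

section NotGrothendieck

/-- The map induced on ultrafilters is continuous. -/
theorem _root_.Ultrafilter.continuous_map {α β : Type*} (f : α → β) :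
    Continuous (Ultrafilter.map f) := by
  refine ultrafilterBasis_is_basis.continuous_iff.2 ?_
  rintro _ ⟨A, rfl⟩
  exact ultrafilter_isOpen_basic (f ⁻¹' A)

variable (d : Set ℕ → ℝ≥0∞)

/-- The canonical map from ultrafilters on `ℕ` into a copy of the `n`-th row. -/
noncomputable def row (n : ℕ) (b : Bool) (u : Ultrafilter ℕ) : Spc.{u} d :=
  proj.{u} d (u.map fun i => ((n, i), b))

theorem continuous_row (n : ℕ) (b : Bool) : Continuous (row.{u} d n b) :=
  (continuous_proj d).comp (Ultrafilter.continuous_map _)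

variable {d}

theorem row_mem_bx {A} (hA : A ∈ alg d) {n b u} :
    row.{u} d n b u ∈ bx.{u} d A ↔ {i | ((n, i), b) ∈ A} ∈ u := proj_mem_bx hA

theorem IsDiffuseSubmeasure.row_set_mem_alg (hd : IsDiffuseSubmeasure d) (n : ℕ) (b : Bool) :
    copy {p | p.1 = n} b ∈ alg d := by
  refine hd.copy_mem_alg ?_ b
  rw [weight, tsum_eq_single n fun k hk => by simpa [hk] using hd.empty]
  simpa using lt_top_iff_ne_top.2 hd.univ_ne_top

theorem IsDiffuseSubmeasure.row_mem_bx_copy (hd : IsDiffuseSubmeasure d) {n k : ℕ} {b c : Bool}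
    {u : Ultrafilter ℕ} :
    row.{u} d k c u ∈ bx.{u} d (copy {p | p.1 = n} b) ↔ k = n ∧ c = b := by
  rw [row_mem_bx (hd.row_set_mem_alg n b)]
  by_cases h : k = n ∧ c = b
  · simp only [copy, mem_ofPred_eq, h, and_self]
    exact iff_of_true univ_mem trivial
  · simp [copy, h]

/-- A continuous function takes nearly the same values at the two copies of each row, outside a set
of finite weight. -/
theorem IsDiffuseSubmeasure.exists_weight_lt_top_abs_sub_le (hd : IsDiffuseSubmeasure d)
    (f : C(Spc.{u} d, ℝ)) {ε : ℝ} (hε : 0 < ε) :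
    ∃ D, weight d D < ⊤ ∧ ∀ n u, {i | (n, i) ∈ D} ∉ u →
      |f (row.{u} d n false u) - f (row.{u} d n true u)| ≤ ε := by
  have key := isCompact_univ.induction_on (X := Spc.{u} d)
    (p := fun s => ∃ D, weight d D < ⊤ ∧ ∀ n u, {i | (n, i) ∈ D} ∉ u →
      row.{u} d n false u ∈ s → |f (row.{u} d n false u) - f (row.{u} d n true u)| ≤ ε)
    ⟨∅, by simp [hd.weight_empty], by simp⟩
    (fun s t hst ⟨D, hD, h⟩ => ⟨D, hD, fun n u hu hs => h n u hu (hst hs)⟩)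
    (fun s t ⟨D, hD, h⟩ ⟨E, hE, h'⟩ => ⟨D ∪ E,
      (hd.weight_union_le D E).trans_lt (ENNReal.add_lt_top.2 ⟨hD, hE⟩), fun n u hu hst => by
        have hu' : {i | (n, i) ∈ D} ∉ u ∧ {i | (n, i) ∈ E} ∉ u :=
          not_or.1 fun h0 => hu (Ultrafilter.union_mem_iff.2 h0)
        exact hst.elim (h n u hu'.1) (h' n u hu'.2)⟩)
    (fun x _ => by
      have hW : IsOpen {y | |f y - f x| < ε / 2} :=
        isOpen_lt (by fun_prop) continuous_const
      obtain ⟨A, hA, hxA, hAW⟩ := hd.exists_bx_subset hW (x := x) (by simpa using half_pos hε)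
      refine ⟨bx.{u} d A, mem_nhdsWithin_of_mem_nhds ((hd.isClopen_bx hA).isOpen.mem_nhds hxA),
        twist A, hA, fun n u hu hmem => ?_⟩
      have h1 := (row_mem_bx hA).1 hmem
      have h2 : row.{u} d n true u ∈ bx.{u} d A := by
        rw [row_mem_bx hA]
        filter_upwards [h1, Ultrafilter.compl_mem_iff_notMem.2 hu] with i hi hi'
        simp only [twist, mem_compl_iff, mem_ofPred_eq, not_not] at hi'
        exact hi'.1 hi
      have h3 : |f (row.{u} d n false u) - f x| < ε / 2 := hAW hmem
      have h4 : |f (row.{u} d n true u) - f x| < ε / 2 := hAW h2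
      rw [abs_lt] at h3 h4
      rw [abs_le]
      constructor <;> linarith)
  obtain ⟨D, hD, h⟩ := key
  exact ⟨D, hD, fun n u hu => h n u hu (mem_univ _)⟩

variable [MeasurableSpace (Ultrafilter ℕ)] [BorelSpace (Ultrafilter ℕ)]
  {m : Measure (Ultrafilter ℕ)} [IsProbabilityMeasure m]

theorem tendsto_integral_row_sub (hd : IsDiffuseSubmeasure d) (hdm : ∀ D, d D = m {u | D ∈ u})
    (f : C(Spc.{u} d, ℝ)) :
    Tendsto (fun n => ∫ u, f (row.{u} d n false u) ∂m - ∫ u, f (row.{u} d n true u) ∂m) atTop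
      (𝓝 0) := by
  have hint : ∀ n b, Integrable (fun u => f (row.{u} d n b u)) m := fun n b =>
    ContinuousMap.integrable_of_isFiniteMeasure
      (⟨_, f.continuous.comp (continuous_row d n b)⟩ : C(Ultrafilter ℕ, ℝ)) m
  rw [Metric.tendsto_atTop']
  intro ε hε
  obtain ⟨D, hD, hDf⟩ := hd.exists_weight_lt_top_abs_sub_le f (half_pos hε)
  have hlim : Tendsto (fun n => d {i | (n, i) ∈ D}) atTop (𝓝 0) :=
    ENNReal.tendsto_atTop_zero_of_tsum_ne_top hD.ne
  have hlim' : Tendsto (fun n => ε / 2 + 2 * ‖f‖ * (d {i | (n, i) ∈ D}).toReal) atTop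
      (𝓝 (ε / 2 + 2 * ‖f‖ * (0 : ℝ≥0∞).toReal)) :=
    (((ENNReal.tendsto_toReal ENNReal.zero_ne_top).comp hlim).const_mul _).const_add _
  simp only [ENNReal.toReal_zero, mul_zero, add_zero] at hlim'
  obtain ⟨N, hN⟩ := eventually_atTop.1 (hlim'.eventually_lt_const (half_lt_self hε))
  refine ⟨N, fun n hn => lt_of_le_of_lt ?_ (hN n hn.le)⟩
  set R : Set (Ultrafilter ℕ) := {u | {i | (n, i) ∈ D} ∈ u}
  have hR : MeasurableSet R := (ultrafilter_isOpen_basic _).measurableSet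
  have hRi : Integrable (fun u => 2 * ‖f‖ * R.indicator 1 u) m :=
    ((integrable_const (1 : ℝ)).indicator hR).const_mul _
  rw [dist_zero_right, ← integral_sub (hint n false) (hint n true)]
  refine (norm_integral_le_of_norm_le ((integrable_const (ε / 2)).add hRi)
    (ae_of_all _ fun u => ?_)).trans_eq ?_
  · by_cases hu : u ∈ R
    · have h1 := f.norm_coe_le_norm (row.{u} d n false u)
      have h2 := f.norm_coe_le_norm (row.{u} d n true u)
      have h3 := norm_sub_le (f (row.{u} d n false u)) (f (row.{u} d n true u))
      simp only [Pi.add_apply, indicator_of_mem hu, Pi.one_apply]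
      linarith
    · simpa [indicator_of_notMem hu] using hDf n u hu
  · rw [integral_add' (integrable_const _) hRi, integral_const_mul, integral_indicator_one hR]
    simp [hdm, R, measureReal_def]

/-- The weak* null sequence of differences of the two copies of a diffuse measure on the rows
is not weakly null. -/
theorem IsDiffuseSubmeasure.not_grothendieckProp (hd : IsDiffuseSubmeasure d)
    [m.Regular] (hdm : ∀ D, d D = m {u | D ∈ u})
    [MeasurableSpace (Spc.{u} d)] [BorelSpace (Spc.{u} d)] :
    ¬ GrothendieckProp (Spc.{u} d) := by
  intro hG
  let P : ℕ → Bool → Measure (Spc.{u} d) := fun n b => m.map (row.{u} d n b)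
  let V : ℕ → Bool → Set (Spc.{u} d) := fun n b => bx.{u} d (copy {p | p.1 = n} b)
  have hmeas : ∀ n b, Measurable (row.{u} d n b) := fun n b => (continuous_row d n b).measurable
  have hVo : ∀ n b, IsOpen (V n b) := fun n b => (hd.isClopen_bx (hd.row_set_mem_alg n b)).isOpen
  have hPprob : ∀ n b, IsProbabilityMeasure (P n b) := fun n b =>
    Measure.isProbabilityMeasure_map (hmeas n b).aemeasurable
  have hPr : ∀ n b, (P n b).InnerRegular := fun n b =>
    Measure.InnerRegular.map_of_continuous (continuous_row d n b)
  have hsing : ∀ n, P n false ⟂ₘ P n true := fun n => by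
    refine ⟨V n true, (hVo n true).measurableSet, ?_, ?_⟩
    · rw [Measure.map_apply (hmeas n false) (hVo n true).measurableSet]
      simp [V, preimage, hd.row_mem_bx_copy]
    · rw [Measure.map_apply (hmeas n true) (hVo n true).measurableSet.compl]
      simp [V, preimage, hd.row_mem_bx_copy]
  let J : ℕ → JordanDecomposition (Spc.{u} d) := fun n => ⟨P n false, P n true, hsing n⟩
  have hJ : ∀ n, (J n).toSignedMeasure.toJordanDecomposition = J n := fun n =>
    JordanDecomposition.toJordanDecomposition_toSignedMeasure _
  have hweak := hG (fun n => (J n).toSignedMeasure) 0 (fun n => ?_) ?_ ?_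
  · let W : Set (Spc.{u} d) := ⋃ n, V n false
    have hW : MeasurableSet W := (isOpen_iUnion fun n => hVo n false).measurableSet
    let φ : SignedMeasure (Spc.{u} d) →ₗ[ℝ] ℝ :=
      { toFun := fun σ => σ W, map_add' := fun _ _ => rfl, map_smul' := fun _ _ => rfl }
    have hlim := hweak φ ⟨1, fun σ => (abs_apply_le_tvNorm σ hW).trans_eq (one_mul _).symm⟩
    have hval : ∀ n, φ (J n).toSignedMeasure = 1 := fun n => by
      change (J n).toSignedMeasure W = 1
      rw [JordanDecomposition.toSignedMeasure, sub_apply,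
        Measure.toSignedMeasure_apply_measurable hW, Measure.toSignedMeasure_apply_measurable hW]
      change (m.map (row.{u} d n false)).real W - (m.map (row.{u} d n true)).real W = 1
      rw [map_measureReal_apply (hmeas n false) hW, map_measureReal_apply (hmeas n true) hW]
      simp [W, V, preimage, hd.row_mem_bx_copy]
    simp only [hval, map_zero] at hlim
    exact one_ne_zero (tendsto_nhds_unique tendsto_const_nhds hlim)
  · unfold IsRadon SignedMeasure.totalVariation
    rw [hJ]
    change (P n false + P n true).Regular
    infer_instance
  · unfold IsRadon
    rw [SignedMeasure.totalVariation_zero]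
    infer_instance
  · intro f
    have h0 : integ (0 : SignedMeasure (Spc.{u} d)) f = 0 := by
      simp [integ, SignedMeasure.toJordanDecomposition_zero]
    rw [h0]
    refine (tendsto_integral_row_sub hd hdm f).congr fun n => ?_
    rw [integ, hJ]
    change _ = ∫ x, f x ∂(m.map (row.{u} d n false)) - ∫ x, f x ∂(m.map (row.{u} d n true))
    rw [integral_map (hmeas n false).aemeasurable f.continuous.aestronglyMeasurable,
      integral_map (hmeas n true).aemeasurable f.continuous.aestronglyMeasurable]

end NotGrothendieck
end JNP

section BasicallyDisconnected

variable {K : Type*} [TopologicalSpace K]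

/-- In a basically disconnected space, closures of countable unions of clopen sets are clopen. -/
theorem BasicallyDisconnected.isClopen_closure_iUnion (hK : BasicallyDisconnected K)
    {U : ℕ → Set K} (hU : ∀ n, IsClopen (U n)) : IsClopen (closure (⋃ n, U n)) := by
  refine ⟨isClosed_closure, hK _ ?_⟩
  have hle : ∀ n x, ‖(U n).indicator (fun _ => (1 / 2 : ℝ) ^ n) x‖ ≤ (1 / 2 : ℝ) ^ n := fun n x =>
    (norm_indicator_le_norm_self _ _).trans_eq (by simp)
  refine ⟨⟨fun x => ∑' n, (U n).indicator (fun _ => (1 / 2 : ℝ) ^ n) x,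
    continuous_tsum (fun n => (hU n).continuous_indicator continuous_const) summable_geometric_two
      hle⟩, ?_⟩
  ext x
  have hs : Summable fun n => (U n).indicator (fun _ => (1 / 2 : ℝ) ^ n) x :=
    Summable.of_norm_bounded summable_geometric_two fun n => hle n x
  have h0 : ∀ n, 0 ≤ (U n).indicator (fun _ => (1 / 2 : ℝ) ^ n) x := fun n =>
    indicator_nonneg (fun _ _ => by positivity) x
  simp only [mem_compl_iff, mem_iUnion, not_exists, mem_preimage, ContinuousMap.coe_mk,
    mem_singleton_iff]
  rw [← hs.hasSum_iff, hasSum_zero_iff_of_nonneg h0, funext_iff]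
  exact forall_congr' fun n => by simp

/-- In a basically disconnected normal space, every open set contains a clopen neighbourhood of each
of its points. -/
theorem BasicallyDisconnected.exists_isClopen_subset [NormalSpace K] [T1Space K]
    (hK : BasicallyDisconnected K) {U : Set K} (hU : IsOpen U) {x : K} (hx : x ∈ U) :
    ∃ V ⊆ U, IsClopen V ∧ x ∈ V := by
  obtain ⟨f, hf0, hf1, -⟩ := exists_continuous_zero_one_of_isClosed hU.isClosed_compl
    (isClosed_singleton (x := x)) (by simpa using hx)
  have hcl : closure {y | 1 / 2 < f y} ⊆ {y | 1 / 2 ≤ f y} :=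
    closure_minimal (Set.ofPred_subset_ofPred.2 fun y hy => hy.le)
      (isClosed_le continuous_const f.continuous)
  refine ⟨closure {y | 1 / 2 < f y}, fun y hy => ?_, ⟨isClosed_closure, hK _ ?_⟩,
    subset_closure ?_⟩
  · by_contra h
    have h1 := hcl hy
    have h2 := hf0 h
    simp only [mem_ofPred_eq, Pi.zero_apply] at h1 h2
    norm_num [h2] at h1
  · refine ⟨⟨fun y => max (f y - 1 / 2) 0, by fun_prop⟩, ?_⟩
    ext y
    simp
  · have := hf1 rfl
    simp only [Pi.one_apply] at this
    norm_num [this]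

/-- A Boolean homomorphism from the power set of `α` to clopen sets yields a continuous map to the
space of ultrafilters. -/
theorem exists_continuous_surjective_ultrafilter_of_clopens [CompactSpace K] {α : Type*}
    (e : Set α → Set K) (hc : ∀ A, IsOpen (e A)) (huniv : e univ = univ)
    (hunion : ∀ A B, e (A ∪ B) = e A ∪ e B) (hdisj : ∀ A B, Disjoint A B → Disjoint (e A) (e B))
    (hne : ∀ a, (e {a}).Nonempty) : ∃ φ : K → Ultrafilter α, Continuous φ ∧ φ.Surjective := by
  have hmono : ∀ {A B}, A ⊆ B → e A ⊆ e B := fun {A B} h => by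
    rw [← union_eq_self_of_subset_left h, hunion]
    exact subset_union_left
  have hsdiff : ∀ A B, e A ⊆ e (A ∩ B) ∪ e (A \ B) := fun A B => by
    rw [← hunion, inter_union_sdiff]
  let F : K → Filter α := fun y =>
    { sets := {A | y ∈ e A}
      univ_sets := show y ∈ e univ from huniv ▸ mem_univ y
      sets_of_superset := fun h hAB => hmono hAB h
      inter_sets := fun {A B} hA hB => (hsdiff A B hA).resolve_right fun h =>
        (hdisj _ _ disjoint_sdiff_left).notMem_of_mem_left h hB }
  have hF : ∀ y A, Aᶜ ∉ F y ↔ A ∈ F y := fun y A => by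
    change y ∉ e Aᶜ ↔ y ∈ e A
    refine ⟨fun h => ?_, fun h => (hdisj _ _ disjoint_compl_right).notMem_of_mem_left h⟩
    have : y ∈ e (A ∪ Aᶜ) := by rw [union_compl_self, huniv]; trivial
    exact ((hunion _ _ ▸ this :)).resolve_right h
  let φ : K → Ultrafilter α := fun y => Ultrafilter.ofComplNotMemIff (F y) (hF y)
  have hφ : Continuous φ := by
    refine ultrafilterBasis_is_basis.continuous_iff.2 ?_
    rintro _ ⟨A, rfl⟩
    exact hc A
  refine ⟨φ, hφ, range_eq_univ.1 ?_⟩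
  refine (isCompact_range hφ).isClosed.closure_eq.symm.trans ?_
  refine (denseRange_pure.mono ?_).closure_eq
  rintro _ ⟨a, rfl⟩
  obtain ⟨y, hy⟩ := hne a
  refine ⟨y, Ultrafilter.coe_le_coe.1 ?_⟩
  exact le_pure_iff.2 hy

/-- An infinite basically disconnected compact Hausdorff space maps continuously onto the space of
ultrafilters on `ℕ`. -/
theorem BasicallyDisconnected.exists_continuous_surjective_ultrafilter [CompactSpace K] [T2Space K]
    [Infinite K] (hK : BasicallyDisconnected K) :
    ∃ φ : K → Ultrafilter ℕ, Continuous φ ∧ φ.Surjective := by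
  obtain ⟨U, hUi, hUo, hUd⟩ := exists_seq_infinite_isOpen_pairwise_disjoint K
  choose x hx using fun n => (hUi n).nonempty
  choose V hVU hV hxV using fun n => hK.exists_isClopen_subset (hUo n) (hx n)
  have hVd : ∀ {m n}, m ≠ n → Disjoint (V m) (V n) := fun h => (hUd h).mono (hVU _) (hVU _)
  have hconst : ∀ p : Prop, IsClopen {_y : K | p} := fun p =>
    ⟨isClosed_const, isOpen_const⟩
  let T : Set ℕ → Set K := fun A => ⋃ n, {y | y ∈ V n ∧ n ∈ A}
  have hTc : ∀ A, IsClopen (closure (T A)) := fun A =>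
    hK.isClopen_closure_iUnion fun n => (hV n).inter (hconst _)
  have hTo : ∀ A, IsOpen (T A) := fun A =>
    isOpen_iUnion fun n => ((hV n).inter (hconst _)).isOpen
  have hTu : ∀ A B, T (A ∪ B) = T A ∪ T B := fun A B => by
    ext y
    simp only [T, mem_iUnion, mem_union, mem_ofPred_eq, and_or_left, exists_or]
  have hTd : ∀ A B, Disjoint A B → Disjoint (closure (T A)) (closure (T B)) := fun A B h => by
    refine ((Disjoint.closure_left ?_ (hTo B)).symm.closure_left (hTc A).isOpen).symm
    refine disjoint_left.2 fun y hyA hyB => ?_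
    obtain ⟨m, hm, hmA⟩ := mem_iUnion.1 hyA
    obtain ⟨n, hn, hnB⟩ := mem_iUnion.1 hyB
    by_cases hmn : m = n
    · exact h.notMem_of_mem_left hmA (hmn ▸ hnB)
    · exact (hVd hmn).notMem_of_mem_left hm hn
  have hTuniv : ∀ A, closure (T A) ⊆ closure (T univ) := fun A =>
    closure_mono (iUnion_mono fun n y hy => ⟨hy.1, trivial⟩)
  refine exists_continuous_surjective_ultrafilter_of_clopens
    (fun A => closure (T A) ∪ {y | y ∈ (closure (T univ))ᶜ ∧ 0 ∈ A}) (fun A => ?_) ?_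
    (fun A B => ?_) (fun A B h => ?_) (fun n => ?_)
  · exact (hTc A).isOpen.union ((hTc univ).compl.inter (hconst _)).isOpen
  · ext y
    simp [em]
  · ext y
    simp only [hTu, closure_union, mem_union, mem_ofPred_eq]
    tauto
  · refine disjoint_left.2 ?_
    rintro y (h1 | h1) (h2 | h2)
    · exact (hTd A B h).notMem_of_mem_left h1 h2
    · exact h2.1 (hTuniv A h1)
    · exact h1.1 (hTuniv B h2)
    · exact h.notMem_of_mem_left h1.2 h2.2
  · exact ⟨x n, Or.inl (subset_closure (mem_iUnion.2 ⟨n, hxV n, rfl⟩))⟩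

end BasicallyDisconnected

/-- For every infinite basically disconnected compact Hausdorff space `K` there exist a compact
Hausdorff space `L` and a continuous surjection `φ : K → L` such that `L` does not have the
Grothendieck property but has the ℓ₁-Grothendieck property. -/
theorem stmt_7 {K : Type u} [TopologicalSpace K] [CompactSpace K] [T2Space K] [Infinite K]
    (hK : BasicallyDisconnected K) :
    ∃ (L : Type u) (_ : TopologicalSpace L) (_ : MeasurableSpace L) (_ : BorelSpace L),
      CompactSpace L ∧ T2Space L ∧
      (∃ φ : K → L, Continuous φ ∧ Function.Surjective φ) ∧
      ¬ JNP.GrothendieckProp L ∧ JNP.Ell1Grothendieck L := by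
  obtain ⟨d, hd, hG⟩ : ∃ d : Set ℕ → ℝ≥0∞, JNP.IsDiffuseSubmeasure d ∧
      ∀ (_ : MeasurableSpace (JNP.Spc.{u} d)) (_ : BorelSpace (JNP.Spc.{u} d)),
        ¬ JNP.GrothendieckProp (JNP.Spc.{u} d) := by
    let _ : MeasurableSpace (Ultrafilter ℕ) := borel _
    have : BorelSpace (Ultrafilter ℕ) := ⟨rfl⟩
    obtain ⟨m, _, _, hm⟩ := JNP.exists_diffuse_measure
    have hd := JNP.isDiffuseSubmeasure_of_measure hm
    exact ⟨_, hd, fun _ _ => hd.not_grothendieckProp fun _ => rfl⟩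
  obtain ⟨φ, hφ, hφs⟩ := hK.exists_continuous_surjective_ultrafilter
  obtain ⟨e⟩ : Nonempty ((ℕ × ℕ) × Bool ≃ ℕ) := nonempty_equiv_of_countable
  let _ : MeasurableSpace (JNP.Spc.{u} d) := borel _
  have hB : BorelSpace (JNP.Spc.{u} d) := ⟨rfl⟩
  refine ⟨JNP.Spc.{u} d, inferInstance, borel _, hB, inferInstance, inferInstance,
    ⟨fun y => JNP.proj d ((φ y).map e.symm),
      (JNP.continuous_proj d).comp ((Ultrafilter.continuous_map _).comp hφ), fun z => ?_⟩,
    hG _ hB, JNP.ell1Grothendieck_of_finSchur hd.finSchur⟩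
  obtain ⟨u, rfl⟩ := JNP.surjective_proj d z
  obtain ⟨y, hy⟩ := hφs (u.map e)
  exact ⟨y, by simp [hy, Ultrafilter.map_map]⟩
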